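/- arXiv:1004.0400 — 2 statements merged into one kernel-verified Lean document; each statement's English description precedes it below -/
import Mathlib

section
/- For every integer n ≥ 1, lim_{d→1⁻} C_n(d)/(1−d) = 1, and moreover sup_{d∈(0,1)} C_n(d)/(1−d) = 1. -/
open scoped BigOperators

noncomputable section

/-- Output alphabet of the binary deletion channel with `n` input bits:
a length `k ≤ n` together with a binary string of that length. -/
abbrev DelOut (n : ℕ) := Σ k : Fin (n + 1), (Fin (k : ℕ) → Bool)

/-- The subsequence of `x` indexed by `S` (taken in increasing order),
as an element of `DelOut n`. -/
def restrictSub {n : ℕ} (x : Fin n → Bool) (S : Finset (Fin n)) : DelOut n :=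
  ⟨⟨S.card, Nat.lt_succ_of_le (by simpa using Finset.card_le_univ S)⟩,
   fun i => x (S.orderEmbOfFin rfl i)⟩

/-- Transition probability of the binary deletion channel `W_n^d`: each input bit is
deleted independently with probability `d`. -/
def delW {n : ℕ} (d : ℝ) (x : Fin n → Bool) (y : DelOut n) : ℝ :=
  ∑ S : Finset (Fin n),
    if restrictSub x S = y then (1 - d) ^ S.card * d ^ (n - S.card) else 0

/-- Transition probability of the exact deletion channel `W_{n,k}`, which keeps exactly `k`
of the `n` input bits, the kept positions being a uniformly random `k`-subset; `k`-subsets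
are identified with strictly monotone maps `Fin k → Fin n`. -/
def exactW {n k : ℕ} (x : Fin n → Bool) (y : Fin k → Bool) : ℝ :=
  ((Finset.univ.filter fun f : Fin k → Fin n => StrictMono f ∧ x ∘ f = y).card : ℝ) /
    (n.choose k : ℝ)

/-- `p` is a probability distribution on the finite alphabet `α`. -/
def IsDist {α : Type*} [Fintype α] (p : α → ℝ) : Prop :=
  (∀ a, 0 ≤ p a) ∧ ∑ a, p a = 1

/-- Base-2 mutual information `I(X;Y)` between the input `X ~ p` and the output `Y`
of the channel with transition matrix `W`. -/
def mutualInfo {α β : Type*} [Fintype α] [Fintype β] (p : α → ℝ) (W : α → β → ℝ) : ℝ :=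
  ∑ x, ∑ y, p x * W x y * Real.logb 2 (W x y / ∑ x', p x' * W x' y)

/-- `C_n(d) = (1/n) · sup_p I(X ; W_n^d(X))`. -/
def Cn (n : ℕ) (d : ℝ) : ℝ :=
  (1 / (n : ℝ)) * ⨆ p : {p : (Fin n → Bool) → ℝ // IsDist p}, mutualInfo p.1 (delW d)

/-- `C_{n,k} = (1/n) · sup_p I(X ; W_{n,k}(X))`. -/
def Cnk (n k : ℕ) : ℝ :=
  (1 / (n : ℝ)) * ⨆ p : {p : (Fin n → Bool) → ℝ // IsDist p},
    mutualInfo p.1 (exactW (n := n) (k := k))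

/-- Capacity of the binary deletion channel: `C(d) = inf_{n ≥ 1} C_n(d)`. -/
def C (d : ℝ) : ℝ := ⨅ n : {m : ℕ // 1 ≤ m}, Cn n d

/-- Upper bound on mutual information by comparison with an auxiliary output distribution `q`. -/
theorem mutualInfo_le_of_le_rpow_mul {α β : Type*} [Fintype α] [Fintype β] {p : α → ℝ}
    {W : α → β → ℝ} {q c : β → ℝ} (hp : IsDist p) (hW : ∀ x, IsDist (W x))
    (hq : IsDist q) (hWq : ∀ x y, W x y ≤ (2 : ℝ) ^ c y * q y) :
    mutualInfo p W ≤ ∑ x, p x * ∑ y, W x y * c y := by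
  set Q : β → ℝ := fun y => ∑ x, p x * W x y
  have hQ0 : ∀ y, 0 ≤ Q y := fun y =>
    Finset.sum_nonneg fun x _ => mul_nonneg (hp.1 x) ((hW x).1 y)
  have hlog2 : 0 < Real.log 2 := Real.log_pos one_lt_two
  have hpoint : ∀ x y, p x * W x y * Real.logb 2 (W x y / Q y) ≤
      p x * (W x y * c y) + (p x * W x y * (q y / Q y) - p x * W x y) / Real.log 2 := by
    intro x y
    rcases (mul_nonneg (hp.1 x) ((hW x).1 y)).eq_or_lt with h | h
    · rw [← mul_assoc, ← h]; simp
    have hWpos : 0 < W x y := pos_of_mul_pos_right h (hp.1 x)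
    have hqpos : 0 < q y := pos_of_mul_pos_right (hWpos.trans_le (hWq x y)) (by positivity)
    have hQpos : 0 < Q y := h.trans_le <|
      Finset.single_le_sum (f := fun x => p x * W x y)
        (fun x _ => mul_nonneg (hp.1 x) ((hW x).1 y)) (Finset.mem_univ x)
    have hle : Real.logb 2 (W x y / Q y) ≤ c y + (q y / Q y - 1) / Real.log 2 := by
      calc Real.logb 2 (W x y / Q y)
          ≤ Real.logb 2 ((2 : ℝ) ^ c y * (q y / Q y)) := by
            refine Real.logb_le_logb_of_le one_lt_two (by positivity) ?_
            rw [← mul_div_assoc]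
            exact div_le_div_of_nonneg_right (hWq x y) hQpos.le
        _ = c y + Real.log (q y / Q y) / Real.log 2 := by
            rw [Real.logb_mul (by positivity) (by positivity),
              Real.logb_rpow two_pos (by norm_num), Real.log_div_log]
        _ ≤ _ := by
            gcongr
            exact Real.log_le_sub_one_of_pos (by positivity)
    refine (mul_le_mul_of_nonneg_left hle h.le).trans_eq ?_
    ring
  have hsumW : ∑ x, ∑ y, p x * W x y = 1 := by
    simp_rw [← Finset.mul_sum, (hW _).2, mul_one, hp.2]
  have hsumq : ∑ x, ∑ y, p x * W x y * (q y / Q y) ≤ 1 := by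
    rw [Finset.sum_comm, ← hq.2]
    refine Finset.sum_le_sum fun y _ => ?_
    rw [← Finset.sum_mul]
    change Q y * (q y / Q y) ≤ q y
    rcases (hQ0 y).eq_or_lt with h | h
    · rw [← h]; simpa using hq.1 y
    · rw [mul_div_cancel₀ _ h.ne']
  calc mutualInfo p W
      ≤ ∑ x, ∑ y, (p x * (W x y * c y) +
          (p x * W x y * (q y / Q y) - p x * W x y) / Real.log 2) :=
        Finset.sum_le_sum fun x _ => Finset.sum_le_sum fun y _ => hpoint x y
    _ = ∑ x, p x * ∑ y, W x y * c y +
          (∑ x, ∑ y, p x * W x y * (q y / Q y) - 1) / Real.log 2 := by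
        simp_rw [Finset.sum_add_distrib, ← Finset.sum_div, Finset.sum_sub_distrib, hsumW,
          Finset.mul_sum]
    _ ≤ _ := by
        have := div_nonpos_of_nonpos_of_nonneg (sub_nonpos.2 hsumq) hlog2.le
        linarith

theorem sum_delW_mul {n : ℕ} (d : ℝ) (x : Fin n → Bool) (g : DelOut n → ℝ) :
    ∑ y, delW d x y * g y =
      ∑ S : Finset (Fin n), (1 - d) ^ S.card * d ^ (n - S.card) * g (restrictSub x S) := by
  simp_rw [delW, Finset.sum_mul]
  rw [Finset.sum_comm]
  simp [ite_mul]

theorem sum_deletion_weight (n : ℕ) (d : ℝ) :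
    ∑ S : Finset (Fin n), (1 - d) ^ S.card * d ^ (n - S.card) = 1 := by
  simpa using Fintype.sum_pow_mul_eq_add_pow (Fin n) (1 - d) d

theorem isDist_delW {n : ℕ} {d : ℝ} (hd : d ∈ Set.Ioo (0 : ℝ) 1) (x : Fin n → Bool) :
    IsDist (delW d x) := by
  have h0 := hd.1.le
  have h1 : 0 ≤ 1 - d := sub_nonneg.2 hd.2.le
  refine ⟨fun y => Finset.sum_nonneg fun S _ => ?_, ?_⟩
  · split_ifs <;> positivity
  · simpa [sum_deletion_weight] using sum_delW_mul d x fun _ => 1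

theorem sum_deletion_weight_mul_card (n : ℕ) (d : ℝ) :
    ∑ S : Finset (Fin n), (1 - d) ^ S.card * d ^ (n - S.card) * (S.card : ℝ) = n * (1 - d) := by
  have h := congrArg (Polynomial.eval (1 - d)) (bernsteinPolynomial.sum_smul ℝ n)
  rw [← Finset.powerset_univ, Finset.sum_powerset_apply_card
    (fun k => (1 - d) ^ k * d ^ (n - k) * (k : ℝ))]
  simp only [Polynomial.eval_finsetSum, bernsteinPolynomial, nsmul_eq_mul,
    Polynomial.eval_mul, Polynomial.eval_natCast, Polynomial.eval_pow, Polynomial.eval_X,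
    Polynomial.eval_sub, Polynomial.eval_one, sub_sub_cancel] at h
  rw [← h, Finset.card_univ, Fintype.card_fin]
  exact Finset.sum_congr rfl fun k _ => by rw [nsmul_eq_mul]; ring

/-- The output law of the deletion channel under uniformly distributed input. -/
def uniformOutput {n : ℕ} (d : ℝ) (y : DelOut n) : ℝ :=
  n.choose y.1 * ((1 - d) ^ (y.1 : ℕ) * d ^ (n - y.1)) / 2 ^ (y.1 : ℕ)

theorem isDist_uniformOutput {n : ℕ} {d : ℝ} (hd : d ∈ Set.Ioo (0 : ℝ) 1) :
    IsDist (uniformOutput (n := n) d) := by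
  have h0 := hd.1.le
  have h1 : 0 ≤ 1 - d := sub_nonneg.2 hd.2.le
  refine ⟨fun y => by unfold uniformOutput; positivity, ?_⟩
  rw [Fintype.sum_sigma]
  have h : ∀ k : Fin (n + 1), ∑ v : Fin (k : ℕ) → Bool, uniformOutput (n := n) d ⟨k, v⟩ =
      (1 - d) ^ (k : ℕ) * d ^ (n - k) * n.choose k := by
    intro k
    simp only [uniformOutput, Finset.sum_const, Finset.card_univ, Fintype.card_fun,
      Fintype.card_bool, Fintype.card_fin, nsmul_eq_mul, Nat.cast_pow, Nat.cast_ofNat]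
    field_simp
  simp_rw [h]
  rw [Fin.sum_univ_eq_sum_range (fun k => (1 - d) ^ k * d ^ (n - k) * (n.choose k : ℝ)),
    ← add_pow, sub_add_cancel, one_pow]

theorem delW_le {n : ℕ} {d : ℝ} (hd : d ∈ Set.Ioo (0 : ℝ) 1) (x : Fin n → Bool) (y : DelOut n) :
    delW d x y ≤ (2 : ℝ) ^ ((y.1 : ℕ) : ℝ) * uniformOutput d y := by
  have h0 := hd.1.le
  have h1 : 0 ≤ 1 - d := sub_nonneg.2 hd.2.le
  calc delW d x y
      ≤ ∑ S : Finset (Fin n),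
          if S.card = y.1 then (1 - d) ^ (y.1 : ℕ) * d ^ (n - y.1) else 0 := by
        refine Finset.sum_le_sum fun S _ => ?_
        by_cases h : restrictSub x S = y
        · have hc : S.card = y.1 := by rw [← h]; rfl
          rw [if_pos h, if_pos hc, hc]
        · rw [if_neg h]; split_ifs <;> positivity
    _ = n.choose y.1 * ((1 - d) ^ (y.1 : ℕ) * d ^ (n - y.1)) := by
        rw [← Finset.sum_filter, Finset.sum_const, nsmul_eq_mul, ← Finset.powerset_univ,
          ← Finset.powersetCard_eq_filter, Finset.card_powersetCard, Finset.card_univ,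
          Fintype.card_fin]
    _ = _ := by
        rw [uniformOutput, Real.rpow_natCast]
        field_simp

theorem mutualInfo_delW_le {n : ℕ} {d : ℝ} (hd : d ∈ Set.Ioo (0 : ℝ) 1)
    {p : (Fin n → Bool) → ℝ} (hp : IsDist p) : mutualInfo p (delW d) ≤ n * (1 - d) := by
  refine (mutualInfo_le_of_le_rpow_mul hp (isDist_delW hd) (isDist_uniformOutput hd)
    (delW_le hd)).trans_eq ?_
  have h : ∀ x : Fin n → Bool, ∑ y, delW d x y * ((y.1 : ℕ) : ℝ) = n * (1 - d) := fun x => by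
    rw [sum_delW_mul, ← sum_deletion_weight_mul_card]
    rfl
  simp_rw [h]
  rw [← Finset.sum_mul, hp.2, one_mul]

/-- The input law choosing each of the two constant strings with probability `1/2`. -/
def constantInput (n : ℕ) (x : Fin n → Bool) : ℝ :=
  ∑ b : Bool, if x = (fun _ => b) then 1 / 2 else 0

theorem sum_constantInput_mul (n : ℕ) (f : (Fin n → Bool) → ℝ) :
    ∑ x, constantInput n x * f x = ∑ b : Bool, 1 / 2 * f fun _ => b := by
  simp_rw [constantInput, Finset.sum_mul]
  rw [Finset.sum_comm]
  simp only [ite_mul, zero_mul, Finset.sum_ite_eq', Finset.mem_univ, if_true]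

theorem isDist_constantInput (n : ℕ) : IsDist (constantInput n) := by
  refine ⟨fun x => Finset.sum_nonneg fun b _ => by split_ifs <;> norm_num, ?_⟩
  have h := sum_constantInput_mul n fun _ => 1
  simp only [mul_one, Fintype.sum_bool] at h
  rw [h]; norm_num

theorem card_eq_of_restrictSub_eq {n : ℕ} {x x' : Fin n → Bool} {S T : Finset (Fin n)}
    (h : restrictSub x S = restrictSub x' T) : S.card = T.card :=
  congrArg (fun y : DelOut n => (y.1 : ℕ)) h

theorem restrictSub_empty {n : ℕ} (x x' : Fin n → Bool) : restrictSub x ∅ = restrictSub x' ∅ :=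
  Sigma.ext rfl <| heq_of_eq <| funext fun i => i.elim0

theorem restrictSub_const_ne {n : ℕ} {b b' : Bool} (hb : b ≠ b') {S T : Finset (Fin n)}
    (hT : T.Nonempty) : restrictSub (fun _ => b) S ≠ restrictSub (fun _ => b') T := by
  intro h
  have hS : 0 < S.card := by rw [card_eq_of_restrictSub_eq h]; exact hT.card_pos
  have hval : ∀ y : DelOut n, y = restrictSub (fun _ => b') T → ∀ i, y.2 i = b' := by
    rintro _ rfl _; rfl
  exact hb (hval _ h ⟨0, hS⟩)

theorem delW_restrictSub_empty {n : ℕ} (d : ℝ) (x x' : Fin n → Bool) :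
    delW d x (restrictSub x' ∅) = d ^ n := by
  rw [delW, Finset.sum_eq_single ∅]
  · rw [if_pos (restrictSub_empty x x')]; simp
  · intro S _ hS
    refine if_neg fun h => hS ?_
    simpa using card_eq_of_restrictSub_eq h
  · simp

theorem delW_restrictSub_pos {n : ℕ} {d : ℝ} (hd : d ∈ Set.Ioo (0 : ℝ) 1) (x : Fin n → Bool)
    (S : Finset (Fin n)) : 0 < delW d x (restrictSub x S) := by
  have h0 := hd.1
  have h1 : 0 < 1 - d := sub_pos.2 hd.2
  refine Finset.sum_pos' (fun T _ => by split_ifs <;> positivity) ⟨S, Finset.mem_univ S, ?_⟩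
  rw [if_pos rfl]; positivity

theorem delW_const_eq_zero {n : ℕ} (d : ℝ) {b b' : Bool} (hb : b ≠ b') {T : Finset (Fin n)}
    (hT : T.Nonempty) : delW d (fun _ => b) (restrictSub (fun _ => b') T) = 0 :=
  Finset.sum_eq_zero fun _ _ => if_neg (restrictSub_const_ne hb hT)

theorem logb_delW_constantInput {n : ℕ} {d : ℝ} (hd : d ∈ Set.Ioo (0 : ℝ) 1) (b : Bool)
    (S : Finset (Fin n)) :
    Real.logb 2 (delW d (fun _ => b) (restrictSub (fun _ => b) S) /
      ∑ x, constantInput n x * delW d x (restrictSub (fun _ => b) S)) =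
      if S = ∅ then 0 else 1 := by
  rw [sum_constantInput_mul]
  split_ifs with hS
  · subst hS
    have hdn : d ^ n ≠ 0 := pow_ne_zero _ hd.1.ne'
    simp only [delW_restrictSub_empty, Fintype.sum_bool]
    rw [← add_mul, add_halves, one_mul, div_self hdn, Real.logb_one]
  · have hpos := delW_restrictSub_pos hd (fun _ => b) S
    have hsum : ∑ b' : Bool, 1 / 2 * delW d (fun _ => b') (restrictSub (fun _ => b) S) =
        1 / 2 * delW d (fun _ => b) (restrictSub (fun _ => b) S) :=
      Finset.sum_eq_single b (fun b' _ hb' => by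
        rw [delW_const_eq_zero d hb' (Finset.nonempty_iff_ne_empty.2 hS), mul_zero]) (by simp)
    rw [hsum, div_mul_cancel_right₀ hpos.ne', one_div, inv_inv, Real.logb_self_eq_one one_lt_two]

theorem mutualInfo_constantInput {n : ℕ} {d : ℝ} (hd : d ∈ Set.Ioo (0 : ℝ) 1) :
    mutualInfo (constantInput n) (delW d) = 1 - d ^ n := by
  simp_rw [mutualInfo, mul_assoc, ← Finset.mul_sum]
  rw [sum_constantInput_mul]
  have h : ∀ b : Bool, ∑ y, delW d (fun _ => b) y * Real.logb 2 (delW d (fun _ => b) y /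
      ∑ x, constantInput n x * delW d x y) = 1 - d ^ n := by
    intro b
    rw [sum_delW_mul d (fun _ => b) fun y => Real.logb 2 (delW d (fun _ => b) y /
      ∑ x, constantInput n x * delW d x y)]
    simp_rw [logb_delW_constantInput hd]
    have hterm : ∀ S : Finset (Fin n),
        (1 - d) ^ S.card * d ^ (n - S.card) * (if S = ∅ then (0 : ℝ) else 1) =
          (1 - d) ^ S.card * d ^ (n - S.card) - if S = ∅ then d ^ n else 0 := by
      intro S
      split_ifs with hS
      · simp [hS]
      · simp
    simp_rw [hterm, Finset.sum_sub_distrib, sum_deletion_weight]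
    simp
  simp_rw [h]
  rw [Fintype.sum_bool]
  ring

theorem Cn_div_le_one {n : ℕ} (hn : 1 ≤ n) {d : ℝ} (hd : d ∈ Set.Ioo (0 : ℝ) 1) :
    Cn n d / (1 - d) ≤ 1 := by
  have hn' : (0 : ℝ) < n := by exact_mod_cast hn
  have : Nonempty {p : (Fin n → Bool) → ℝ // IsDist p} := ⟨⟨_, isDist_constantInput n⟩⟩
  rw [div_le_one (sub_pos.2 hd.2), Cn, one_div, inv_mul_le_iff₀ hn']
  exact ciSup_le fun p => mutualInfo_delW_le hd p.2

theorem le_Cn_div {n : ℕ} {d : ℝ} (hd : d ∈ Set.Ioo (0 : ℝ) 1) :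
    (1 / n : ℝ) * ∑ i ∈ Finset.range n, d ^ i ≤ Cn n d / (1 - d) := by
  have h1 : 0 < 1 - d := sub_pos.2 hd.2
  rw [le_div_iff₀ h1, mul_assoc, geom_sum_mul_neg, Cn]
  refine mul_le_mul_of_nonneg_left ?_ (by positivity)
  rw [← mutualInfo_constantInput hd]
  refine le_ciSup (f := fun p : {p : (Fin n → Bool) → ℝ // IsDist p} =>
    mutualInfo p.1 (delW d)) ⟨n * (1 - d), ?_⟩ ⟨_, isDist_constantInput n⟩
  rintro _ ⟨p, rfl⟩
  exact mutualInfo_delW_le hd p.2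

/-- For every `n ≥ 1`, `lim_{d→1⁻} C_n(d)/(1−d) = 1`, and moreover
`sup_{d ∈ (0,1)} C_n(d)/(1−d) = 1`. -/
theorem Cn_ratio_limit_and_sup (n : ℕ) (hn : 1 ≤ n) :
    Filter.Tendsto (fun d : ℝ => Cn n d / (1 - d)) (nhdsWithin 1 (Set.Iio 1)) (nhds 1) ∧
    (⨆ d : Set.Ioo (0 : ℝ) 1, Cn n d / (1 - (d : ℝ))) = 1 := by
  have hn' : (n : ℝ) ≠ 0 := by positivity
  have hmem : Set.Ioo (0 : ℝ) 1 ∈ nhdsWithin (1 : ℝ) (Set.Iio 1) := Ioo_mem_nhdsLT one_pos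
  have hcont : Continuous fun d : ℝ => (1 / n : ℝ) * ∑ i ∈ Finset.range n, d ^ i := by fun_prop
  have hlow : Filter.Tendsto (fun d : ℝ => (1 / n : ℝ) * ∑ i ∈ Finset.range n, d ^ i)
      (nhdsWithin 1 (Set.Iio 1)) (nhds 1) := by
    have h := (hcont.tendsto 1).mono_left (nhdsWithin_le_nhds (s := Set.Iio 1))
    simpa [hn'] using h
  have hlim : Filter.Tendsto (fun d : ℝ => Cn n d / (1 - d))
      (nhdsWithin 1 (Set.Iio 1)) (nhds 1) :=
    tendsto_of_tendsto_of_tendsto_of_le_of_le' hlow tendsto_const_nhds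
      (Filter.mem_of_superset hmem fun _ hd => le_Cn_div hd)
      (Filter.mem_of_superset hmem fun _ hd => Cn_div_le_one hn hd)
  refine ⟨hlim, le_antisymm ?_ ?_⟩
  · have : Nonempty (Set.Ioo (0 : ℝ) 1) := ⟨⟨1 / 2, by norm_num, by norm_num⟩⟩
    exact ciSup_le fun d => Cn_div_le_one hn d.2
  · refine le_of_tendsto hlim (Filter.mem_of_superset hmem fun d hd => ?_)
    refine le_ciSup (f := fun d : Set.Ioo (0 : ℝ) 1 => Cn n d / (1 - (d : ℝ))) ⟨1, ?_⟩ ⟨d, hd⟩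
    rintro _ ⟨d, rfl⟩
    exact Cn_div_le_one hn d.2
end
end

section
/- For all integers 1 ≤ k ≤ n, limsup_{d→1⁻} C(d)/(1−d) ≤ (n·C_{n,k} + 1)/(k + 1). -/
open scoped BigOperators

noncomputable section

/-! ### The log-sum inequality -/

/-- The summand `a * log₂ (a / b)` of a relative entropy. -/
def entropyTerm (a b : ℝ) : ℝ := a * Real.logb 2 (a / b)

@[simp] lemma entropyTerm_zero_left (b : ℝ) : entropyTerm 0 b = 0 := by simp [entropyTerm]

lemma entropyTerm_mul_left {c a b : ℝ} : entropyTerm (c * a) (c * b) = c * entropyTerm a b := by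
  rcases eq_or_ne c 0 with rfl | hc
  · simp
  · rw [entropyTerm, entropyTerm, mul_div_mul_left _ _ hc, mul_assoc]

lemma entropyTerm_mul_mul {a a' c c' : ℝ} (ha : a' = 0 → a = 0) (hc : c' = 0 → c = 0) :
    entropyTerm (a * c) (a' * c') = c * entropyTerm a a' + a * entropyTerm c c' := by
  rcases eq_or_ne a 0 with rfl | ha0
  · simp
  rcases eq_or_ne c 0 with rfl | hc0
  · simp
  have ha' : a' ≠ 0 := fun h => ha0 (ha h)
  have hc' : c' ≠ 0 := fun h => hc0 (hc h)
  rw [entropyTerm, entropyTerm, entropyTerm, mul_div_mul_comm,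
    Real.logb_mul (div_ne_zero ha0 ha') (div_ne_zero hc0 hc')]
  ring

lemma entropyTerm_le_mul {a b : ℝ} {j : ℕ} (ha : 0 ≤ a) (hb : 0 ≤ b) (h : a ≤ 2 ^ j * b) :
    entropyTerm a b ≤ j * a := by
  rcases ha.eq_or_lt with rfl | ha0
  · simp
  have hb0 : 0 < b := by
    rcases hb.eq_or_lt with rfl | hb0
    · simp at h; linarith
    · exact hb0
  rw [entropyTerm, mul_comm (j : ℝ)]
  refine mul_le_mul_of_nonneg_left ?_ ha
  rw [Real.logb_le_iff_le_rpow one_lt_two (div_pos ha0 hb0), Real.rpow_natCast]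
  rwa [div_le_iff₀ hb0]

lemma entropyTerm_tangent {a b A B : ℝ} (ha : 0 ≤ a) (hb : 0 ≤ b) (h : b = 0 → a = 0)
    (hA : 0 < A) (hB : 0 < B) :
    a * Real.logb 2 (A / B) + (a - b * (A / B)) / Real.log 2 ≤ entropyTerm a b := by
  have hl : 0 < Real.log 2 := Real.log_pos one_lt_two
  rcases ha.eq_or_lt with rfl | ha0
  · have : 0 ≤ b * (A / B) / Real.log 2 := by positivity
    simp only [zero_mul, zero_sub, zero_add, entropyTerm_zero_left, neg_div]
    linarith
  have hb0 : 0 < b := lt_of_le_of_ne hb fun h0 => ha0.ne' (h h0.symm)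
  have key := Real.log_le_sub_one_of_pos (x := (A / B) / (a / b)) (by positivity)
  rw [Real.log_div (by positivity) (by positivity)] at key
  rw [entropyTerm, Real.logb, Real.logb, ← mul_div_assoc a, ← mul_div_assoc a, ← add_div]
  refine div_le_div_of_nonneg_right ?_ hl.le
  have h1 := mul_le_mul_of_nonneg_left key ha
  have h2 : a * (A / B / (a / b) - 1) = b * (A / B) - a := by field_simp
  rw [h2] at h1
  linarith

lemma entropyTerm_sum_le {ι : Type*} (s : Finset ι) (a b : ι → ℝ) (ha : ∀ i ∈ s, 0 ≤ a i)
    (hb : ∀ i ∈ s, 0 ≤ b i) (h : ∀ i ∈ s, b i = 0 → a i = 0) :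
    entropyTerm (∑ i ∈ s, a i) (∑ i ∈ s, b i) ≤ ∑ i ∈ s, entropyTerm (a i) (b i) := by
  rcases (Finset.sum_nonneg ha).eq_or_lt with h0 | hA
  · have hz := (Finset.sum_eq_zero_iff_of_nonneg ha).1 h0.symm
    rw [← h0, entropyTerm_zero_left]
    exact (Finset.sum_eq_zero fun i hi => by rw [hz i hi, entropyTerm_zero_left]).ge
  have hB : 0 < ∑ i ∈ s, b i := by
    refine lt_of_le_of_ne (Finset.sum_nonneg hb) fun h0 => hA.ne' ?_
    have hz := (Finset.sum_eq_zero_iff_of_nonneg hb).1 h0.symm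
    exact Finset.sum_eq_zero fun i hi => h i hi (hz i hi)
  refine le_trans (le_of_eq ?_)
    (Finset.sum_le_sum fun i hi => entropyTerm_tangent (ha i hi) (hb i hi) (h i hi) hA hB)
  rw [Finset.sum_add_distrib, ← Finset.sum_mul, ← Finset.sum_div, Finset.sum_sub_distrib,
    ← Finset.sum_mul, mul_div_cancel₀ _ hB.ne', sub_self, zero_div, add_zero, entropyTerm]

lemma sum_entropyTerm_nonneg {ι : Type*} (s : Finset ι) (a b : ι → ℝ) (ha : ∀ i ∈ s, 0 ≤ a i)
    (hb : ∀ i ∈ s, 0 ≤ b i) (h : ∀ i ∈ s, b i = 0 → a i = 0)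
    (hab : ∑ i ∈ s, b i ≤ ∑ i ∈ s, a i) : 0 ≤ ∑ i ∈ s, entropyTerm (a i) (b i) := by
  refine le_trans ?_ (entropyTerm_sum_le s a b ha hb h)
  rcases (Finset.sum_nonneg hb).eq_or_lt with h0 | hB
  · simp [entropyTerm, ← h0]
  · exact mul_nonneg (Finset.sum_nonneg ha)
      (Real.logb_nonneg one_lt_two ((one_le_div hB).2 hab))

/-! ### Information bounds witnessed by an output measure -/

/-- `InfoBound p K T μ r` says that some output measure `q` on `T` of mass at most `μ` satisfies
`∑ x, p x * D(K x ‖ q) ≤ r`, all sums over outputs being restricted to `T`. -/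
def InfoBound {X Y : Type*} [Fintype X] (p : X → ℝ) (K : X → Y → ℝ) (T : Finset Y)
    (μ r : ℝ) : Prop :=
  ∃ q : Y → ℝ, (∀ y ∈ T, 0 ≤ q y) ∧ (∀ y ∈ T, q y = 0 → ∀ x, K x y = 0) ∧
    ∑ y ∈ T, q y ≤ μ ∧ ∑ x, p x * ∑ y ∈ T, entropyTerm (K x y) (q y) ≤ r

namespace InfoBound

variable {X Y Y' : Type*} [Fintype X] {p : X → ℝ}

lemma mono {K : X → Y → ℝ} {T : Finset Y} {μ r r' : ℝ} (h : InfoBound p K T μ r)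
    (hr : r ≤ r') : InfoBound p K T μ r' := by
  obtain ⟨q, h0, h1, h2, h3⟩ := h
  exact ⟨q, h0, h1, h2, h3.trans hr⟩

lemma congr {K K' : X → Y → ℝ} {T : Finset Y} {μ r : ℝ} (h : InfoBound p K T μ r)
    (hK : ∀ x, ∀ y ∈ T, K' x y = K x y) : InfoBound p K' T μ r := by
  obtain ⟨q, h0, h1, h2, h3⟩ := h
  refine ⟨q, h0, fun y hy hq x => (hK x y hy).trans (h1 y hy hq x), h2, le_trans (le_of_eq ?_) h3⟩
  refine Finset.sum_congr rfl fun x _ => congrArg _ (Finset.sum_congr rfl fun y hy => ?_)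
  rw [hK x y hy]

lemma scale {K : X → Y → ℝ} {T : Finset Y} {μ r c : ℝ} (hc : 0 ≤ c)
    (h : InfoBound p K T μ r) : InfoBound p (fun x y => c * K x y) T (c * μ) (c * r) := by
  obtain ⟨q, h0, h1, h2, h3⟩ := h
  refine ⟨fun y => c * q y, fun y hy => mul_nonneg hc (h0 y hy), fun y hy hq x => ?_, ?_, ?_⟩
  · rcases mul_eq_zero.1 hq with h | h
    · simp [h]
    · simp [h1 y hy h x]
  · rw [← Finset.mul_sum]
    exact mul_le_mul_of_nonneg_left h2 hc
  · refine le_trans (le_of_eq ?_) (mul_le_mul_of_nonneg_left h3 hc)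
    simp only [entropyTerm_mul_left, ← Finset.mul_sum]
    rw [Finset.mul_sum]
    exact Finset.sum_congr rfl fun x _ => by ring

lemma sum (hp : ∀ x, 0 ≤ p x) {ι : Type*} (s : Finset ι) {K : ι → X → Y → ℝ} {T : Finset Y}
    {μ r : ι → ℝ} (hK : ∀ i ∈ s, ∀ x, ∀ y ∈ T, 0 ≤ K i x y)
    (h : ∀ i ∈ s, InfoBound p (K i) T (μ i) (r i)) :
    InfoBound p (fun x y => ∑ i ∈ s, K i x y) T (∑ i ∈ s, μ i) (∑ i ∈ s, r i) := by
  choose! q h0 h1 h2 h3 using h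
  refine ⟨fun y => ∑ i ∈ s, q i y, fun y hy => Finset.sum_nonneg fun i hi => h0 i hi y hy,
    fun y hy hq x => ?_, ?_, ?_⟩
  · have hz := (Finset.sum_eq_zero_iff_of_nonneg fun i hi => h0 i hi y hy).1 hq
    exact Finset.sum_eq_zero fun i hi => h1 i hi y hy (hz i hi) x
  · rw [Finset.sum_comm]
    exact Finset.sum_le_sum h2
  · calc ∑ x, p x * ∑ y ∈ T, entropyTerm (∑ i ∈ s, K i x y) (∑ i ∈ s, q i y)
        ≤ ∑ x, p x * ∑ y ∈ T, ∑ i ∈ s, entropyTerm (K i x y) (q i y) := by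
          refine Finset.sum_le_sum fun x _ => mul_le_mul_of_nonneg_left ?_ (hp x)
          exact Finset.sum_le_sum fun y hy => entropyTerm_sum_le s _ _
            (fun i hi => hK i hi x y hy) (fun i hi => h0 i hi y hy)
            fun i hi hq => h1 i hi y hy hq x
      _ = ∑ i ∈ s, ∑ x, p x * ∑ y ∈ T, entropyTerm (K i x y) (q i y) := by
          rw [Finset.sum_comm]
          refine Finset.sum_congr rfl fun x _ => ?_
          rw [Finset.sum_comm, Finset.mul_sum]
      _ ≤ ∑ i ∈ s, r i := Finset.sum_le_sum h3

lemma union [DecidableEq Y] {K : X → Y → ℝ} {T₁ T₂ : Finset Y} (hT : Disjoint T₁ T₂)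
    {μ₁ μ₂ r₁ r₂ : ℝ} (h₁ : InfoBound p K T₁ μ₁ r₁) (h₂ : InfoBound p K T₂ μ₂ r₂) :
    InfoBound p K (T₁ ∪ T₂) (μ₁ + μ₂) (r₁ + r₂) := by
  obtain ⟨q₁, a0, a1, a2, a3⟩ := h₁
  obtain ⟨q₂, b0, b1, b2, b3⟩ := h₂
  have e₁ : ∀ y ∈ T₁, (if y ∈ T₁ then q₁ y else q₂ y) = q₁ y := fun y hy => if_pos hy
  have e₂ : ∀ y ∈ T₂, (if y ∈ T₁ then q₁ y else q₂ y) = q₂ y :=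
    fun y hy => if_neg (Finset.disjoint_right.1 hT hy)
  refine ⟨fun y => if y ∈ T₁ then q₁ y else q₂ y, fun y hy => ?_, fun y hy => ?_, ?_, ?_⟩
  · rcases Finset.mem_union.1 hy with h | h
    · simpa only [e₁ y h] using a0 y h
    · simpa only [e₂ y h] using b0 y h
  · rcases Finset.mem_union.1 hy with h | h
    · simpa only [e₁ y h] using a1 y h
    · simpa only [e₂ y h] using b1 y h
  · rw [Finset.sum_union hT, Finset.sum_congr rfl e₁, Finset.sum_congr rfl e₂]
    exact add_le_add a2 b2
  · refine le_trans (le_of_eq ?_) (add_le_add a3 b3)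
    rw [← Finset.sum_add_distrib]
    refine Finset.sum_congr rfl fun x _ => ?_
    rw [Finset.sum_union hT, mul_add]
    congr 2
    · exact Finset.sum_congr rfl fun y hy => by simp only [e₁ y hy]
    · exact Finset.sum_congr rfl fun y hy => by simp only [e₂ y hy]

lemma prod {K : X → Y → ℝ} {K' : X → Y' → ℝ} {T : Finset Y} {T' : Finset Y'}
    {r r' : ℝ} (hK : ∀ x, ∑ y ∈ T, K x y = 1) (hK' : ∀ x, ∑ y ∈ T', K' x y = 1)
    (h : InfoBound p K T 1 r) (h' : InfoBound p K' T' 1 r') :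
    InfoBound p (fun x (y : Y × Y') => K x y.1 * K' x y.2) (T ×ˢ T') 1 (r + r') := by
  obtain ⟨q, a0, a1, a2, a3⟩ := h
  obtain ⟨q', b0, b1, b2, b3⟩ := h'
  refine ⟨fun y => q y.1 * q' y.2, fun y hy => ?_, fun y hy hq x => ?_, ?_, ?_⟩
  · rw [Finset.mem_product] at hy
    exact mul_nonneg (a0 _ hy.1) (b0 _ hy.2)
  · rw [Finset.mem_product] at hy
    rcases mul_eq_zero.1 hq with h | h
    · simp [a1 _ hy.1 h x]
    · simp [b1 _ hy.2 h x]
  · rw [Finset.sum_product' (f := fun a b => q a * q' b), ← Finset.sum_mul_sum]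
    exact mul_le_one₀ a2 (Finset.sum_nonneg b0) b2
  · refine le_trans (le_of_eq ?_) (add_le_add a3 b3)
    rw [← Finset.sum_add_distrib]
    refine Finset.sum_congr rfl fun x _ => ?_
    rw [← mul_add]
    congr 1
    rw [Finset.sum_product' (f := fun a b => entropyTerm (K x a * K' x b) (q a * q' b))]
    calc ∑ a ∈ T, ∑ b ∈ T', entropyTerm (K x a * K' x b) (q a * q' b)
        = ∑ a ∈ T, ∑ b ∈ T', (K' x b * entropyTerm (K x a) (q a)
            + K x a * entropyTerm (K' x b) (q' b)) := by
          refine Finset.sum_congr rfl fun a ha => Finset.sum_congr rfl fun b hb => ?_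
          exact entropyTerm_mul_mul (fun h => a1 a ha h x) fun h => b1 b hb h x
      _ = _ := by
          simp only [Finset.sum_add_distrib, ← Finset.mul_sum, ← Finset.sum_mul, hK, hK', one_mul]

lemma subset {K : X → Y → ℝ} {T T' : Finset Y} {μ r : ℝ} (hT : T ⊆ T')
    (hK : ∀ y ∈ T', y ∉ T → ∀ x, K x y = 0) (h : InfoBound p K T' μ r) :
    InfoBound p K T μ r := by
  obtain ⟨q, h0, h1, h2, h3⟩ := h
  refine ⟨q, fun y hy => h0 y (hT hy), fun y hy => h1 y (hT hy),
    (Finset.sum_le_sum_of_subset_of_nonneg hT fun y hy _ => h0 y hy).trans h2,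
    le_trans (le_of_eq ?_) h3⟩
  refine Finset.sum_congr rfl fun x _ => ?_
  rw [Finset.sum_subset hT fun y hy hn => by rw [hK y hy hn x, entropyTerm_zero_left]]

lemma image_iff [DecidableEq Y'] {e : Y → Y'} (he : Function.Injective e) {K : X → Y' → ℝ}
    {T : Finset Y} {μ r : ℝ} :
    InfoBound p K (T.image e) μ r ↔ InfoBound p (fun x y => K x (e y)) T μ r := by
  constructor
  · rintro ⟨q, h0, h1, h2, h3⟩
    rw [Finset.sum_image he.injOn] at h2
    simp only [Finset.sum_image he.injOn] at h3
    exact ⟨fun y => q (e y), fun y hy => h0 _ (Finset.mem_image_of_mem e hy),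
      fun y hy => h1 _ (Finset.mem_image_of_mem e hy), h2, h3⟩
  · rintro ⟨q, h0, h1, h2, h3⟩
    have hq : ∀ y, Function.extend e q 0 (e y) = q y := fun y => he.extend_apply q 0 y
    refine ⟨Function.extend e q 0, ?_, ?_, ?_, ?_⟩
    · simpa only [Finset.forall_mem_image, hq] using h0
    · simpa only [Finset.forall_mem_image, hq] using h1
    · simpa only [Finset.sum_image he.injOn, hq] using h2
    · simpa only [Finset.sum_image he.injOn, hq] using h3

end InfoBound

/-! ### Mutual information -/

lemma mutualInfo_nonneg {α β : Type*} [Fintype α] [Fintype β] {p : α → ℝ} {W : α → β → ℝ}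
    (hp : IsDist p) (hW : ∀ x y, 0 ≤ W x y) (hW1 : ∀ x, ∑ y, W x y = 1) :
    0 ≤ mutualInfo p W := by
  have hout : ∑ y, ∑ x, p x * W x y = 1 := by
    rw [Finset.sum_comm]
    simp only [← Finset.mul_sum, hW1, mul_one, hp.2]
  refine Finset.sum_nonneg fun x _ => ?_
  simp only [mul_assoc, ← Finset.mul_sum]
  rcases (hp.1 x).eq_or_lt with h0 | hpos
  · simp [← h0]
  refine mul_nonneg hpos.le (sum_entropyTerm_nonneg Finset.univ (W x) _ (fun y _ => hW x y)
    (fun y _ => Finset.sum_nonneg fun x' _ => mul_nonneg (hp.1 x') (hW x' y))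
    (fun y _ h => ?_) ?_)
  · have := (Finset.sum_eq_zero_iff_of_nonneg
      fun x' _ => mul_nonneg (hp.1 x') (hW x' y)).1 h x (Finset.mem_univ x)
    exact (mul_eq_zero.1 this).resolve_left hpos.ne'
  · rw [hout, hW1]

lemma mutualInfo_le_of_infoBound {α β : Type*} [Fintype α] [Fintype β] {p : α → ℝ}
    {W : α → β → ℝ} (hp : IsDist p) (hW : ∀ x y, 0 ≤ W x y) (hW1 : ∀ x, ∑ y, W x y = 1) {r : ℝ}
    (h : InfoBound (fun x : {x // p x ≠ 0} => p x) (fun x => W x) Finset.univ 1 r) :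
    mutualInfo p W ≤ r := by
  classical
  obtain ⟨q, h0, h1, h2, h3⟩ := h
  have hsub : ∀ f : α → ℝ, ∑ x : {x // p x ≠ 0}, p x * f x = ∑ x, p x * f x := fun f => by
    rw [← Finset.sum_subtype (Finset.univ.filter fun x => p x ≠ 0) (by simp)
      (fun x => p x * f x), Finset.sum_filter]
    refine Finset.sum_congr rfl fun x _ => ?_
    by_cases hx : p x = 0 <;> simp [hx]
  set out : β → ℝ := fun y => ∑ x, p x * W x y with hout_def
  have hterm : ∀ x y, 0 ≤ p x * W x y := fun x y => mul_nonneg (hp.1 x) (hW x y)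
  have hout0 : ∀ y, 0 ≤ out y := fun y => Finset.sum_nonneg fun x _ => hterm x y
  have hout1 : ∑ y, out y = 1 := by
    rw [Finset.sum_comm]
    simp only [← Finset.mul_sum, hW1, mul_one, hp.2]
  have hq : ∀ y, q y = 0 → ∀ x, p x * W x y = 0 := fun y hy x => by
    by_cases hx : p x = 0
    · simp [hx]
    · simp [h1 y (Finset.mem_univ y) hy ⟨x, hx⟩]
  have hout : ∀ y, q y = 0 → out y = 0 := fun y hy => Finset.sum_eq_zero fun x _ => hq y hy x
  have hgibbs : 0 ≤ ∑ y, entropyTerm (out y) (q y) :=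
    sum_entropyTerm_nonneg _ _ _ (fun y _ => hout0 y) h0 (fun y _ => hout y) (by rwa [hout1])
  have hsplit : ∀ x y, p x * entropyTerm (W x y) (q y)
      = p x * W x y * Real.logb 2 (W x y / out y)
        + p x * W x y * Real.logb 2 (out y / q y) := fun x y => by
    rw [entropyTerm, ← mul_assoc, ← mul_add]
    by_cases hx : p x * W x y = 0
    · simp [hx]
    have ho : out y ≠ 0 := fun h => hx
      ((Finset.sum_eq_zero_iff_of_nonneg fun x' _ => hterm x' y).1 h x (Finset.mem_univ x))
    have hq0 : q y ≠ 0 := fun h => hx (hq y h x)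
    have hw : W x y ≠ 0 := right_ne_zero_of_mul hx
    rw [← Real.logb_mul (div_ne_zero hw ho) (div_ne_zero ho hq0), div_mul_div_cancel₀ ho]
  rw [hsub fun x => ∑ y, entropyTerm (W x y) (q y)] at h3
  simp only [Finset.mul_sum, hsplit, Finset.sum_add_distrib] at h3
  rw [Finset.sum_comm (f := fun x y => p x * W x y * Real.logb 2 (out y / q y))] at h3
  simp only [← Finset.sum_mul] at h3
  change mutualInfo p W + ∑ y, entropyTerm (out y) (q y) ≤ r at h3
  linarith

/-! ### Counting embeddings of words -/

/-- The number of occurrences of `y` as a subsequence of `x`. -/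
def embCount : List Bool → List Bool → ℕ
  | _, [] => 1
  | [], _ :: _ => 0
  | a :: x, b :: y => embCount x (b :: y) + if a = b then embCount x y else 0

@[simp] lemma embCount_nil_right (x : List Bool) : embCount x [] = 1 := by
  cases x <;> rfl

@[simp] lemma embCount_nil_cons (b : Bool) (y : List Bool) : embCount [] (b :: y) = 0 := rfl

lemma embCount_cons_cons (a b : Bool) (x y : List Bool) :
    embCount (a :: x) (b :: y) = embCount x (b :: y) + if a = b then embCount x y else 0 := rfl

lemma embCount_append_cons (b : Bool) (y₂ : List Bool) (x y₁ : List Bool) :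
    embCount x (y₁ ++ b :: y₂) = ∑ s ∈ Finset.range x.length,
      embCount (x.take s) y₁ * ((if x[s]? = some b then 1 else 0) *
        embCount (x.drop (s + 1)) y₂) := by
  induction x generalizing y₁ with
  | nil => cases y₁ <;> simp
  | cons a x ih =>
    rw [List.length_cons, Finset.sum_range_succ']
    cases y₁ with
    | nil =>
      have := ih []
      simp only [List.nil_append, embCount_nil_right, one_mul] at this
      simp [embCount_cons_cons, this]
    | cons c y₁ =>
      have h1 := ih (c :: y₁)
      have h2 := ih y₁
      rw [List.cons_append] at h1 ⊢
      rw [embCount_cons_cons, h1, h2]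
      by_cases hac : a = c
      · simp only [List.take_succ_cons, embCount_cons_cons, hac, if_true, add_mul,
          Finset.sum_add_distrib, List.getElem?_cons_succ, List.drop_succ_cons, List.take_zero,
          embCount_nil_cons, zero_mul, add_zero]
      · simp [embCount_cons_cons, hac]

lemma sum_embCount_eraseIdx (x y : List Bool) :
    (∑ i ∈ Finset.range x.length, (embCount (x.eraseIdx i) y : ℝ))
      = ((x.length : ℝ) - y.length) * embCount x y := by
  induction x generalizing y with
  | nil => cases y <;> simp
  | cons a x ih =>
    rw [List.length_cons, Finset.sum_range_succ']
    cases y with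
    | nil => simp
    | cons b y =>
      have h1 := ih (b :: y)
      have h2 := ih y
      simp only [List.length_cons, Nat.cast_add, Nat.cast_one] at h1 ⊢
      by_cases hab : a = b
      · simp only [List.eraseIdx_cons_succ, List.eraseIdx_cons_zero, embCount_cons_cons, hab,
          if_true, Nat.cast_add, Finset.sum_add_distrib, h1, h2]
        ring
      · simp only [List.eraseIdx_cons_succ, List.eraseIdx_cons_zero, embCount_cons_cons, hab,
          if_false, add_zero, h1]
        ring

/-- The binary words of length `j`. -/
def words (j : ℕ) : Finset (List Bool) := Finset.univ.image (List.ofFn : (Fin j → Bool) → _)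

lemma mem_words {j : ℕ} {y : List Bool} : y ∈ words j ↔ y.length = j := by
  simp only [words, Finset.mem_image, Finset.mem_univ, true_and]
  constructor
  · rintro ⟨v, rfl⟩
    simp
  · rintro rfl
    exact ⟨y.get, List.ofFn_get y⟩

lemma sum_words_zero {M : Type*} [AddCommMonoid M] (f : List Bool → M) :
    ∑ y ∈ words 0, f y = f [] := by
  rw [show words 0 = {[]} from Finset.ext fun y => by simp [mem_words], Finset.sum_singleton]

lemma sum_words_succ {M : Type*} [AddCommMonoid M] (j : ℕ) (f : List Bool → M) :
    ∑ y ∈ words (j + 1), f y = ∑ b, ∑ y ∈ words j, f (b :: y) := by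
  rw [← Finset.sum_product' (f := fun b y => f (b :: y))]
  refine (Finset.sum_nbij (fun z : Bool × List Bool => z.1 :: z.2) ?_ ?_ ?_ ?_).symm
  · rintro ⟨b, y⟩ h
    simpa [mem_words] using h
  · rintro ⟨b, y⟩ _ ⟨b', y'⟩ _ h
    simpa using h
  · rintro y hy
    cases y with
    | nil => simp [mem_words] at hy
    | cons b y => exact ⟨(b, y), by simpa [mem_words] using hy, rfl⟩
  · intros
    rfl

lemma card_words (j : ℕ) : (words j).card = 2 ^ j := by
  rw [words, Finset.card_image_of_injective _ List.ofFn_injective]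
  simp

lemma sum_embCount (x : List Bool) (j : ℕ) :
    ∑ y ∈ words j, embCount x y = x.length.choose j := by
  induction x generalizing j with
  | nil =>
    cases j with
    | zero => simp [sum_words_zero]
    | succ j => simp [sum_words_succ]
  | cons a x ih =>
    cases j with
    | zero => simp [sum_words_zero]
    | succ j =>
      have h := ih (j + 1)
      rw [sum_words_succ] at h
      simp only [sum_words_succ, embCount_cons_cons, Finset.sum_add_distrib, h, List.length_cons]
      rw [Nat.choose_succ_succ', add_comm, ← ih j]
      cases a <;> simp

lemma embCount_le_choose (x y : List Bool) : embCount x y ≤ x.length.choose y.length := by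
  rw [← sum_embCount]
  exact Finset.single_le_sum (fun _ _ => Nat.zero_le _) (mem_words.2 rfl)

/-- The binary words of length less than `M`. -/
def wordsLT (M : ℕ) : Finset (List Bool) := (Finset.range M).biUnion words

lemma mem_wordsLT {M : ℕ} {y : List Bool} : y ∈ wordsLT M ↔ y.length < M := by
  simp [wordsLT, mem_words]

lemma sum_wordsLT {R : Type*} [AddCommMonoid R] (M : ℕ) (f : List Bool → R) :
    ∑ y ∈ wordsLT M, f y = ∑ j ∈ Finset.range M, ∑ y ∈ words j, f y := by
  refine Finset.sum_biUnion fun i _ j _ hij => Finset.disjoint_left.2 fun y hi hj => hij ?_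
  rw [← mem_words.1 hi, mem_words.1 hj]

/-! ### The exact deletion channel on words -/

/-- Transition probability of the exact deletion channel keeping `k` letters of the word `x`. -/
def exactProb (k : ℕ) (x y : List Bool) : ℝ := embCount x y / x.length.choose k

lemma exactProb_nonneg (k : ℕ) (x y : List Bool) : 0 ≤ exactProb k x y := by
  unfold exactProb
  positivity

lemma sum_exactProb {k : ℕ} {x : List Bool} (h : k ≤ x.length) :
    ∑ y ∈ words k, exactProb k x y = 1 := by
  have hc : (x.length.choose k : ℝ) ≠ 0 := by exact_mod_cast (Nat.choose_pos h).ne'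
  simp only [exactProb, ← Finset.sum_div]
  rw [← Nat.cast_sum, sum_embCount, div_self hc]

lemma exactProb_eq_sum_eraseIdx {k : ℕ} {x y : List Bool} (hy : y.length = k)
    (hx : k < x.length) :
    exactProb k x y
      = ∑ i ∈ Finset.range x.length, (x.length : ℝ)⁻¹ * exactProb k (x.eraseIdx i) y := by
  obtain ⟨s, hs⟩ : ∃ s, x.length = s + 1 := ⟨x.length - 1, by omega⟩
  have hlen : ∀ i ∈ Finset.range x.length, (x.eraseIdx i).length = s := fun i hi => by
    rw [List.length_eraseIdx_of_lt (Finset.mem_range.1 hi), hs, Nat.add_sub_cancel]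
  have hks : k ≤ s := by omega
  have hc : (s.choose k : ℝ) ≠ 0 := by exact_mod_cast (Nat.choose_pos hks).ne'
  have hc' : ((s + 1).choose k : ℝ) ≠ 0 := by exact_mod_cast (Nat.choose_pos (by omega)).ne'
  have hch : ((s + 1 : ℕ) : ℝ) * s.choose k = (s + 1).choose k * (((s + 1 : ℕ) : ℝ) - k) := by
    have h2 := Nat.choose_mul_succ_eq s k
    have h3 : ((s.choose k * (s + 1) : ℕ) : ℝ) = (((s + 1).choose k * (s + 1 - k) : ℕ) : ℝ) := by
      rw [h2]
    rw [Nat.cast_mul, Nat.cast_mul, Nat.cast_sub (by omega)] at h3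
    linarith
  calc exactProb k x y
      = (x.length : ℝ)⁻¹ * ((∑ i ∈ Finset.range x.length, (embCount (x.eraseIdx i) y : ℝ))
          / s.choose k) := by
        rw [sum_embCount_eraseIdx, exactProb, hs, hy]
        have : ((s + 1 : ℕ) : ℝ) ≠ 0 := by positivity
        field_simp
        linear_combination (embCount x y : ℝ) * hch
    _ = _ := by
        rw [Finset.sum_div, Finset.mul_sum]
        refine Finset.sum_congr rfl fun i hi => ?_
        rw [exactProb, hlen i hi]

section ExactBounds

variable {X : Type} [Fintype X] {p : X → ℝ}

lemma infoBound_exactProb_uniform (hp0 : ∀ x, 0 ≤ p x) (hp : ∑ x, p x = 1) (k : ℕ)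
    (g : X → List Bool) :
    InfoBound p (fun x => exactProb k (g x)) (words k) 1 k := by
  have hle : ∀ x, ∑ y ∈ words k, exactProb k (g x) y ≤ 1 := fun x => by
    simp only [exactProb, ← Finset.sum_div]
    rw [← Nat.cast_sum, sum_embCount]
    exact div_self_le_one _
  refine ⟨fun _ => (2 ^ k)⁻¹, fun y _ => by positivity, fun y _ h => ?_, ?_, ?_⟩
  · exact absurd h (by positivity)
  · rw [Finset.sum_const, card_words, nsmul_eq_mul]
    simp
  · calc ∑ x, p x * ∑ y ∈ words k, entropyTerm (exactProb k (g x) y) (2 ^ k)⁻¹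
        ≤ ∑ x, p x * k := by
          refine Finset.sum_le_sum fun x _ => mul_le_mul_of_nonneg_left ?_ (hp0 x)
          calc _ ≤ ∑ y ∈ words k, k * exactProb k (g x) y := by
                refine Finset.sum_le_sum fun y hy => entropyTerm_le_mul
                  (exactProb_nonneg _ _ _) (by positivity) ?_
                rw [mul_inv_cancel₀ (by positivity)]
                exact (Finset.single_le_sum (fun y _ => exactProb_nonneg k (g x) y) hy).trans
                  (hle x)
            _ ≤ k := by
                rw [← Finset.mul_sum]
                exact mul_le_of_le_one_right (by positivity) (hle x)
      _ = k := by rw [← Finset.sum_mul, hp, one_mul]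

lemma InfoBound.exactProb_of_le (hp0 : ∀ x, 0 ≤ p x) {k n : ℕ} (hkn : k ≤ n) {r : ℝ}
    (h : ∀ g : X → List Bool, (∀ x, (g x).length = n) →
      InfoBound p (fun x => exactProb k (g x)) (words k) 1 r)
    {s : ℕ} (hs : n ≤ s) (g : X → List Bool) (hg : ∀ x, (g x).length = s) :
    InfoBound p (fun x => exactProb k (g x)) (words k) 1 r := by
  induction s, hs using Nat.le_induction generalizing g with
  | base => exact h g hg
  | succ s hs ih =>
    have key := InfoBound.sum hp0 (Finset.range (s + 1))
      (K := fun i x y => ((s + 1 : ℕ) : ℝ)⁻¹ * exactProb k ((g x).eraseIdx i) y) (T := words k)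
      (fun i _ x y _ => mul_nonneg (by positivity) (exactProb_nonneg _ _ _))
      (fun i hi => (ih (fun x => (g x).eraseIdx i) fun x => by
        rw [List.length_eraseIdx_of_lt (by rw [hg]; exact Finset.mem_range.1 hi), hg,
          Nat.add_sub_cancel]).scale (by positivity))
    have hne : ((s + 1 : ℕ) : ℝ) ≠ 0 := by positivity
    simp only [Finset.sum_const, Finset.card_range, nsmul_eq_mul] at key
    rw [mul_inv_cancel_left₀ hne, mul_inv_cancel_left₀ hne] at key
    refine key.congr fun x y hy => ?_
    rw [exactProb_eq_sum_eraseIdx (mem_words.1 hy) (by rw [hg]; omega), hg]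

end ExactBounds

/-! ### Binomial masses -/

/-- The binomial mass `C(N, j) d ^ (N - j) (1 - d) ^ j`, written in terms of the odds
`ρ = (1 - d) / d`. -/
def binomMass (d ρ : ℝ) (N j : ℕ) : ℝ := N.choose j * (d ^ N * ρ ^ j)

section BinomMass

variable {d ρ : ℝ}

lemma binomMass_nonneg (hd : 0 ≤ d) (hρ : 0 ≤ ρ) (N j : ℕ) : 0 ≤ binomMass d ρ N j := by
  unfold binomMass
  positivity

lemma binomMass_succ_succ (N j : ℕ) :
    binomMass d ρ (N + 1) (j + 1) = d * binomMass d ρ N (j + 1) + d * ρ * binomMass d ρ N j := by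
  simp only [binomMass, Nat.choose_succ_succ', Nat.cast_add]
  ring

lemma binomMass_succ_zero (N : ℕ) : binomMass d ρ (N + 1) 0 = d * binomMass d ρ N 0 := by
  simp only [binomMass, Nat.choose_zero_right]
  ring

lemma sum_binomMass_succ (hdρ : d + d * ρ = 1) (N k : ℕ) :
    ∑ j ∈ Finset.range (k + 1), binomMass d ρ (N + 1) j
      = ∑ j ∈ Finset.range (k + 1), binomMass d ρ N j - d * ρ * binomMass d ρ N k := by
  induction k with
  | zero =>
    simp only [zero_add, Finset.sum_range_one, binomMass_succ_zero]
    linear_combination binomMass d ρ N 0 * hdρ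
  | succ k ih =>
    rw [Finset.sum_range_succ, ih, Finset.sum_range_succ _ (k + 1), binomMass_succ_succ]
    linear_combination binomMass d ρ N (k + 1) * hdρ

lemma sum_mul_binomMass_succ (hdρ : d + d * ρ = 1) (N k : ℕ) :
    ∑ j ∈ Finset.range (k + 1), (j : ℝ) * binomMass d ρ (N + 1) j
      = ∑ j ∈ Finset.range (k + 1), (j : ℝ) * binomMass d ρ N j
        + d * ρ * ∑ j ∈ Finset.range (k + 1), binomMass d ρ N j
        - d * ρ * ((k + 1) * binomMass d ρ N k) := by
  induction k with
  | zero => simp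
  | succ k ih =>
    rw [Finset.sum_range_succ, ih, Finset.sum_range_succ _ (k + 1),
      Finset.sum_range_succ (fun j => binomMass d ρ N j) (k + 1), binomMass_succ_succ]
    push_cast
    linear_combination ((k : ℝ) + 1) * binomMass d ρ N (k + 1) * hdρ

/-- The position of the `(k + 1)`-st kept letter is either among the first `N`, or at most
`k` of these are kept. -/
lemma sum_waiting_add_sum_binomMass (hdρ : d + d * ρ = 1) (k N : ℕ) :
    ∑ s ∈ Finset.range N, d * ρ * binomMass d ρ s k
      + ∑ j ∈ Finset.range (k + 1), binomMass d ρ N j = 1 := by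
  induction N with
  | zero =>
    rw [Finset.sum_range_succ']
    simp [binomMass]
  | succ N ih =>
    rw [Finset.sum_range_succ, sum_binomMass_succ hdρ]
    linarith

lemma sum_binomMass_of_lt (hdρ : d + d * ρ = 1) {N M : ℕ} (h : N < M) :
    ∑ j ∈ Finset.range M, binomMass d ρ N j = 1 := by
  obtain ⟨k, rfl⟩ : ∃ k, M = k + 1 := ⟨M - 1, by omega⟩
  rw [← sum_waiting_add_sum_binomMass hdρ k N, right_eq_add]
  refine Finset.sum_eq_zero fun s hs => ?_
  rw [binomMass, Nat.choose_eq_zero_of_lt (by have := Finset.mem_range.1 hs; omega)]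
  simp

/-- Wald's identity for the waiting time of the `(k + 1)`-st kept letter, truncated at `N`. -/
lemma wald_binomMass (hdρ : d + d * ρ = 1) (k N : ℕ) :
    d * ρ * (∑ s ∈ Finset.range N, d * ρ * binomMass d ρ s k * (s + 1)
        + N * ∑ j ∈ Finset.range (k + 1), binomMass d ρ N j)
      = (k + 1) * ∑ s ∈ Finset.range N, d * ρ * binomMass d ρ s k
        + ∑ j ∈ Finset.range (k + 1), (j : ℝ) * binomMass d ρ N j := by
  induction N with
  | zero =>
    have h0 : ∑ j ∈ Finset.range (k + 1), (j : ℝ) * binomMass d ρ 0 j = 0 :=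
      Finset.sum_eq_zero fun j _ => by cases j <;> simp [binomMass]
    simp [h0]
  | succ N ih =>
    rw [Finset.sum_range_succ _ N, Finset.sum_range_succ _ N, sum_binomMass_succ hdρ,
      sum_mul_binomMass_succ hdρ]
    push_cast
    linear_combination ih

end BinomMass

/-! ### The deletion channel on words -/

/-- Transition probability of the deletion channel on words, in terms of the odds
`ρ = (1 - d) / d`. -/
def delProb (d ρ : ℝ) (x y : List Bool) : ℝ := embCount x y * (d ^ x.length * ρ ^ y.length)

section DelProb

variable {d ρ : ℝ}

lemma delProb_nonneg (hd : 0 ≤ d) (hρ : 0 ≤ ρ) (x y : List Bool) : 0 ≤ delProb d ρ x y := by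
  unfold delProb
  positivity

lemma delProb_eq_zero {x y : List Bool} (h : x.length < y.length) : delProb d ρ x y = 0 := by
  have := embCount_le_choose x y
  rw [Nat.choose_eq_zero_of_lt h, Nat.le_zero] at this
  simp [delProb, this]

lemma sum_delProb (x : List Bool) (j : ℕ) :
    ∑ y ∈ words j, delProb d ρ x y = binomMass d ρ x.length j := by
  rw [binomMass, ← sum_embCount, Nat.cast_sum, Finset.sum_mul]
  refine Finset.sum_congr rfl fun y hy => ?_
  rw [delProb, mem_words.1 hy]

lemma sum_delProb_wordsLT (hdρ : d + d * ρ = 1) {x : List Bool} {M : ℕ} (h : x.length < M) :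
    ∑ y ∈ wordsLT M, delProb d ρ x y = 1 := by
  rw [sum_wordsLT, Finset.sum_congr rfl fun j _ => sum_delProb x j, sum_binomMass_of_lt hdρ h]

/-- Decomposition of the deletion channel according to the position of the `(k + 1)`-st kept
letter. -/
lemma delProb_append_cons {k : ℕ} (x : List Bool) {y₁ : List Bool} (hy₁ : y₁.length = k)
    (b : Bool) (y₂ : List Bool) :
    delProb d ρ x (y₁ ++ b :: y₂) = ∑ s ∈ Finset.range x.length,
      d * ρ * binomMass d ρ s k * (exactProb k (x.take s) y₁ *
        ((if x[s]? = some b then 1 else 0) * delProb d ρ (x.drop (s + 1)) y₂)) := by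
  rw [delProb, embCount_append_cons, Nat.cast_sum, Finset.sum_mul]
  refine Finset.sum_congr rfl fun s hs => ?_
  have hs := Finset.mem_range.1 hs
  have hlen : (x.take s).length = s := by rw [List.length_take]; omega
  have hE := embCount_le_choose (x.take s) y₁
  rw [hlen, hy₁] at hE
  have hpow : d ^ x.length = d ^ s * d * d ^ (x.length - (s + 1)) := by
    rw [← pow_succ, ← pow_add]
    congr 1
    omega
  rw [binomMass, exactProb, hlen, delProb, List.length_drop, hpow, List.length_append,
    List.length_cons, hy₁]
  rcases Nat.eq_zero_or_pos (s.choose k) with h0 | hpos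
  · have : embCount (x.take s) y₁ = 0 := by omega
    simp [this]
  · have hc : (s.choose k : ℝ) ≠ 0 := by exact_mod_cast hpos.ne'
    push_cast
    field_simp
    ring

variable {X : Type} [Fintype X] {p : X → ℝ}

lemma infoBound_letter (hp0 : ∀ x, 0 ≤ p x) (hp : ∑ x, p x = 1) {s : ℕ} (g : X → List Bool)
    (hg : ∀ x, s < (g x).length) :
    (∀ x, ∑ b, (if (g x)[s]? = some b then 1 else 0 : ℝ) = 1) ∧
    InfoBound p (fun x (b : Bool) => if (g x)[s]? = some b then 1 else 0) Finset.univ 1 1 := by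
  have hsum : ∀ x, ∑ b, (if (g x)[s]? = some b then 1 else 0 : ℝ) = 1 := fun x => by
    rw [List.getElem?_eq_getElem (hg x)]
    simp
  refine ⟨hsum, fun _ => 1 / 2, fun _ _ => by norm_num, fun _ _ h => by norm_num at h,
    by norm_num, ?_⟩
  calc _ ≤ ∑ x, p x * 1 := by
        refine Finset.sum_le_sum fun x _ => mul_le_mul_of_nonneg_left ?_ (hp0 x)
        refine le_trans (Finset.sum_le_sum fun b _ =>
          entropyTerm_le_mul (j := 1) ?_ (by norm_num) ?_) ?_
        · dsimp only
          split_ifs <;> norm_num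
        · dsimp only
          split_ifs <;> norm_num
        · rw [← Finset.mul_sum, hsum]
          norm_num
    _ = 1 := by simp [hp]

lemma infoBound_delProb_short (hd : 0 < d) (hρ : 0 < ρ) (hp0 : ∀ x, 0 ≤ p x)
    (hp : ∑ x, p x = 1) (k N : ℕ) (g : X → List Bool) (hg : ∀ x, (g x).length = N) :
    InfoBound p (fun x => delProb d ρ (g x)) (wordsLT (k + 1))
      (∑ j ∈ Finset.range (k + 1), binomMass d ρ N j)
      (k * ∑ j ∈ Finset.range (k + 1), binomMass d ρ N j) := by
  have hb := binomMass_nonneg hd.le hρ.le N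
  have hle : ∀ x y, delProb d ρ (g x) y ≤ binomMass d ρ N y.length := fun x y => by
    rw [← hg x, ← sum_delProb]
    exact Finset.single_le_sum (f := delProb d ρ (g x))
      (fun y _ => delProb_nonneg hd.le hρ.le _ _) (mem_words.2 rfl)
  refine ⟨fun y => (2 ^ y.length)⁻¹ * binomMass d ρ N y.length,
    fun y _ => mul_nonneg (by positivity) (hb _), fun y _ h x => ?_, ?_, ?_⟩
  · have h0 : binomMass d ρ N y.length = 0 := (mul_eq_zero.1 h).resolve_left (by positivity)
    exact le_antisymm (h0 ▸ hle x y) (delProb_nonneg hd.le hρ.le _ _)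
  · rw [sum_wordsLT]
    refine Finset.sum_le_sum fun j _ => le_of_eq ?_
    rw [Finset.sum_congr rfl fun y hy => by rw [mem_words.1 hy], Finset.sum_const, card_words,
      nsmul_eq_mul, Nat.cast_pow, Nat.cast_ofNat, mul_inv_cancel_left₀ (by positivity)]
  · calc _ ≤ ∑ x, p x * (k * ∑ j ∈ Finset.range (k + 1), binomMass d ρ N j) := by
          refine Finset.sum_le_sum fun x _ => mul_le_mul_of_nonneg_left ?_ (hp0 x)
          rw [sum_wordsLT, Finset.mul_sum]
          refine Finset.sum_le_sum fun j hj => ?_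
          rw [← hg x, ← sum_delProb, Finset.mul_sum]
          refine Finset.sum_le_sum fun y hy => ?_
          have hjk : (y.length : ℝ) ≤ k := by
            rw [mem_words.1 hy]
            exact_mod_cast Nat.lt_succ_iff.1 (Finset.mem_range.1 hj)
          refine (entropyTerm_le_mul (j := y.length) (delProb_nonneg hd.le hρ.le _ _)
            (mul_nonneg (by positivity) (hg x ▸ hb _)) ?_).trans
            (mul_le_mul_of_nonneg_right hjk (delProb_nonneg hd.le hρ.le _ _))
          rw [mul_inv_cancel_left₀ (by positivity), hg x]
          exact hle x y
      _ = _ := by rw [← Finset.sum_mul, hp, one_mul]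

lemma append_cons_injective (k : ℕ) :
    Function.Injective fun z : (Fin k → Bool) × Bool × List Bool =>
      List.ofFn z.1 ++ z.2.1 :: z.2.2 := by
  rintro ⟨v, b, z⟩ ⟨v', b', z'⟩ h
  have h' := List.append_inj h (by simp)
  simp only [List.cons.injEq] at h'
  obtain ⟨h1, rfl, rfl⟩ := h'
  rw [List.ofFn_injective h1]

/-- Revealing the position of the `(k + 1)`-st kept letter splits the deletion channel into an
exact deletion channel, a single letter and a shorter deletion channel. -/
lemma infoBound_delProb (hd : 0 < d) (hρ : 0 < ρ) (hdρ : d + d * ρ = 1) (hp0 : ∀ x, 0 ≤ p x)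
    (hp : ∑ x, p x = 1) (k : ℕ) {a : ℝ} {G : ℕ → ℝ}
    (hG : ∀ s, ∀ g : X → List Bool, (∀ x, (g x).length = s) →
      InfoBound p (fun x => exactProb k (g x)) (words k) 1 (G s))
    (ha : ∀ N, ∑ s ∈ Finset.range N, d * ρ * binomMass d ρ s k * (G s + 1) ≤
      a * (∑ s ∈ Finset.range N, d * ρ * binomMass d ρ s k * (s + 1)
        + N * ∑ j ∈ Finset.range (k + 1), binomMass d ρ N j))
    {N M : ℕ} (hNM : N < M) (g : X → List Bool) (hg : ∀ x, (g x).length = N) :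
    InfoBound p (fun x => delProb d ρ (g x)) (wordsLT M) 1 (N * a + k) := by
  induction N using Nat.strong_induction_on generalizing M g with
  | _ N ih =>
  have hπ : ∀ s, 0 ≤ d * ρ * binomMass d ρ s k := fun s =>
    mul_nonneg (by positivity) (binomMass_nonneg hd.le hρ.le s k)
  set e : (Fin k → Bool) × Bool × List Bool → List Bool :=
    fun z => List.ofFn z.1 ++ z.2.1 :: z.2.2 with he
  have hparts : ∀ s ∈ Finset.range N, InfoBound p
      (fun x (z : (Fin k → Bool) × Bool × List Bool) => d * ρ * binomMass d ρ s k *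
        (exactProb k ((g x).take s) (List.ofFn z.1) *
          ((if (g x)[s]? = some z.2.1 then 1 else 0) * delProb d ρ ((g x).drop (s + 1)) z.2.2)))
      (Finset.univ ×ˢ Finset.univ ×ˢ wordsLT M)
      (d * ρ * binomMass d ρ s k * 1)
      (d * ρ * binomMass d ρ s k * (G s + (1 + ((N - (s + 1) : ℕ) * a + k)))) := by
    intro s hs
    have hs := Finset.mem_range.1 hs
    rcases lt_or_ge s k with hsk | hks
    · have h0 : binomMass d ρ s k = 0 := by simp [binomMass, Nat.choose_eq_zero_of_lt hsk]
      exact ⟨0, by simp, by simp [h0], by simp [h0], by simp [h0]⟩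
    have htake : ∀ x, ((g x).take s).length = s := fun x => by
      rw [List.length_take, hg]
      omega
    have hdrop : ∀ x, ((g x).drop (s + 1)).length = N - (s + 1) := fun x => by
      rw [List.length_drop, hg]
    obtain ⟨hbit1, hbit⟩ := infoBound_letter hp0 hp (s := s) g fun x => by rw [hg]; exact hs
    have hdel := ih (N - (s + 1)) (by omega) (M := M) (by omega) _ hdrop
    have hdel1 : ∀ x, ∑ y ∈ wordsLT M, delProb d ρ ((g x).drop (s + 1)) y = 1 := fun x =>
      sum_delProb_wordsLT hdρ (by rw [hdrop]; omega)
    have hex := hG s (fun x => (g x).take s) htake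
    rw [words, InfoBound.image_iff List.ofFn_injective] at hex
    have hex1 : ∀ x, ∑ v : Fin k → Bool, exactProb k ((g x).take s) (List.ofFn v) = 1 :=
      fun x => by
        rw [← sum_exactProb (k := k) (x := (g x).take s) (by rw [htake]; exact hks), words,
          Finset.sum_image List.ofFn_injective.injOn]
    refine (InfoBound.prod hex1 (fun x => ?_) hex (InfoBound.prod hbit1 hdel1 hbit hdel)).scale
      (hπ s)
    rw [Finset.sum_product' (f := fun b y =>
      (if (g x)[s]? = some b then 1 else 0) * delProb d ρ ((g x).drop (s + 1)) y),
      ← Finset.sum_mul_sum, hbit1, hdel1, one_mul]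
  have hlong : InfoBound p (fun x => delProb d ρ (g x))
      ((Finset.univ ×ˢ Finset.univ ×ˢ wordsLT M).image e) _ _ :=
    (InfoBound.image_iff (append_cons_injective k)).2 <|
      (InfoBound.sum hp0 (Finset.range N) (fun s _ x z _ => mul_nonneg (hπ s) <|
        mul_nonneg (exactProb_nonneg _ _ _) <| mul_nonneg (by split_ifs <;> norm_num)
          (delProb_nonneg hd.le hρ.le _ _)) hparts).congr
        fun x z _ => by rw [delProb_append_cons (g x) (List.length_ofFn), hg]
  have hdisj : Disjoint (wordsLT (k + 1))
      ((Finset.univ ×ˢ Finset.univ ×ˢ wordsLT M).image e) := by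
    rw [Finset.disjoint_left]
    intro y hy hy'
    obtain ⟨z, -, rfl⟩ := Finset.mem_image.1 hy'
    simp only [he, mem_wordsLT, List.length_append, List.length_ofFn, List.length_cons] at hy
    omega
  have hall := (infoBound_delProb_short hd hρ hp0 hp k N g hg).union hdisj hlong
  rw [add_comm (∑ j ∈ Finset.range (k + 1), binomMass d ρ N j)] at hall
  simp only [mul_one] at hall
  have hmass := sum_waiting_add_sum_binomMass hdρ k N
  rw [hmass] at hall
  refine (hall.subset ?_ ?_).mono ?_
  · intro y hy
    rw [mem_wordsLT] at hy
    rw [Finset.mem_union, mem_wordsLT]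
    rcases lt_or_ge y.length (k + 1) with h | h
    · exact Or.inl h
    right
    have hk : k < y.length := h
    have hlen : (y.take k).length = k := by rw [List.length_take]; omega
    obtain ⟨v, hv⟩ : ∃ v : Fin k → Bool, List.ofFn v = y.take k := by
      have := mem_words.2 hlen
      simpa [words] using this
    refine Finset.mem_image.2 ⟨(v, y[k], y.drop (k + 1)), ?_, ?_⟩
    · simp only [Finset.mem_product, Finset.mem_univ, true_and, mem_wordsLT, List.length_drop]
      omega
    · simp only [he, hv]
      rw [← List.drop_eq_getElem_cons hk, List.take_append_drop]
  · intro y _ hy x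
    rw [mem_wordsLT, not_lt] at hy
    exact delProb_eq_zero (by rw [hg]; omega)
  · have hsum : ∑ s ∈ Finset.range N, d * ρ * binomMass d ρ s k *
        (G s + (1 + ((N - (s + 1) : ℕ) * a + k)))
        = ∑ s ∈ Finset.range N, d * ρ * binomMass d ρ s k * (G s + 1)
          + (N * a + k) * ∑ s ∈ Finset.range N, d * ρ * binomMass d ρ s k
          - a * ∑ s ∈ Finset.range N, d * ρ * binomMass d ρ s k * (s + 1) := by
      rw [Finset.mul_sum, Finset.mul_sum, ← Finset.sum_add_distrib, ← Finset.sum_sub_distrib]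
      refine Finset.sum_congr rfl fun s hs => ?_
      rw [Nat.cast_sub (Finset.mem_range.1 hs)]
      push_cast
      ring
    rw [hsum]
    have haN := ha N
    have hP : ∑ s ∈ Finset.range N, d * ρ * binomMass d ρ s k
        = 1 - ∑ j ∈ Finset.range (k + 1), binomMass d ρ N j := by linarith
    rw [hP]
    linarith

end DelProb

/-! ### Comparison with the channels on tuples -/

lemma card_strictMono_comp_eq {n k : ℕ} (x : Fin n → Bool) (y : Fin k → Bool) :
    (Finset.univ.filter fun f : Fin k → Fin n => StrictMono f ∧ x ∘ f = y).card
      = embCount (List.ofFn x) (List.ofFn y) := by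
  induction n generalizing k with
  | zero =>
    cases k with
    | zero =>
      simp only [List.ofFn_zero, embCount_nil_right]
      rw [Finset.filter_true_of_mem fun f _ => ⟨fun i => i.elim0, funext fun i => i.elim0⟩]
      simp
    | succ k => simp [List.ofFn_succ]
  | succ n ih =>
    cases k with
    | zero =>
      simp only [List.ofFn_zero, embCount_nil_right]
      rw [Finset.filter_true_of_mem fun f _ => ⟨fun i => i.elim0, funext fun i => i.elim0⟩]
      simp
    | succ k =>
      have h1 := ih (fun i => x i.succ) y
      have h2 := ih (fun i => x i.succ) fun i => y i.succ
      rw [List.ofFn_succ (f := y)] at h1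
      rw [List.ofFn_succ (f := x), List.ofFn_succ (f := y), embCount_cons_cons, ← h1, ← h2,
        ← Finset.card_filter_add_card_filter_not (fun f : Fin (k + 1) → Fin (n + 1) => f 0 ≠ 0)]
      congr 1
      · refine (Finset.card_bij (fun f _ => fun i => (f i).succ) ?_ ?_ ?_).symm
        · intro f hf
          simp only [Finset.mem_filter, Finset.mem_univ, true_and] at hf ⊢
          exact ⟨⟨fun i j hij => Fin.succ_lt_succ_iff.2 (hf.1 hij), hf.2⟩, Fin.succ_ne_zero _⟩
        · intro f _ f' _ h
          exact funext fun i => Fin.succ_injective _ (congrFun h i)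
        · intro f hf
          simp only [Finset.mem_filter, Finset.mem_univ, true_and] at hf
          obtain ⟨⟨hm, hx⟩, h0⟩ := hf
          have hne : ∀ i, f i ≠ 0 := fun i =>
            ((Fin.pos_iff_ne_zero.2 h0).trans_le (hm.monotone (Fin.zero_le i))).ne'
          refine ⟨fun i => (f i).pred (hne i), ?_, ?_⟩
          · simp only [Finset.mem_filter, Finset.mem_univ, true_and]
            refine ⟨fun i j hij => Fin.pred_lt_pred_iff.2 (hm hij), ?_⟩
            rw [← hx]
            funext i
            simp
          · funext i
            simp
      · split_ifs with hxy
        · refine (Finset.card_bij (fun f _ => Fin.cons 0 fun i => (f i).succ) ?_ ?_ ?_).symm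
          · intro f hf
            simp only [Finset.mem_filter, Finset.mem_univ, true_and, not_not] at hf ⊢
            refine ⟨⟨?_, ?_⟩, rfl⟩
            · intro i j
              refine Fin.cases (fun h => absurd h (Fin.not_lt_zero i)) (fun j => ?_) j
              refine Fin.cases (fun _ => Fin.succ_pos (f j)) (fun i hij => ?_) i
              exact Fin.succ_lt_succ_iff.2 (hf.1 (Fin.succ_lt_succ_iff.1 hij))
            · funext i
              refine Fin.cases hxy (fun i => ?_) i
              exact congrFun hf.2 i
          · intro f _ f' _ h
            have := Fin.cons_right_injective (α := fun _ => Fin (n + 1)) 0 h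
            exact funext fun i => Fin.succ_injective _ (congrFun this i)
          · intro f hf
            simp only [Finset.mem_filter, Finset.mem_univ, true_and, not_not] at hf
            obtain ⟨⟨hm, hx⟩, h0⟩ := hf
            have hne : ∀ i : Fin k, f i.succ ≠ 0 := fun i =>
              (h0 ▸ hm (Fin.succ_pos i) : 0 < f i.succ).ne'
            refine ⟨fun i => (f i.succ).pred (hne i), ?_, ?_⟩
            · simp only [Finset.mem_filter, Finset.mem_univ, true_and]
              refine ⟨fun i j hij => Fin.pred_lt_pred_iff.2 (hm (Fin.succ_lt_succ_iff.2 hij)), ?_⟩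
              rw [← hx]
              funext i
              simp
            · funext i
              refine Fin.cases (by simp [h0]) (fun i => by simp) i
        · rw [Finset.card_eq_zero, Finset.filter_eq_empty_iff]
          intro f hf
          simp only [Finset.mem_filter, Finset.mem_univ, true_and] at hf
          rw [not_not]
          intro h0
          exact hxy (by rw [← hf.2, Function.comp_apply, h0])

lemma exactW_eq_exactProb {n k : ℕ} (x : Fin n → Bool) (y : Fin k → Bool) :
    exactW x y = exactProb k (List.ofFn x) (List.ofFn y) := by
  rw [exactW, card_strictMono_comp_eq, exactProb, List.length_ofFn]

lemma restrictSub_eq {n k : ℕ} (x : Fin n → Bool) (S : Finset (Fin n)) (h : S.card = k)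
    (hk : k < n + 1) :
    restrictSub x S = ⟨⟨k, hk⟩, fun i => x (S.orderEmbOfFin h i)⟩ := by
  subst h
  rfl

lemma card_restrictSub_eq {n : ℕ} (x : Fin n → Bool) (y : DelOut n) :
    (Finset.univ.filter fun S : Finset (Fin n) => restrictSub x S = y).card
      = embCount (List.ofFn x) (List.ofFn y.2) := by
  rw [← card_strictMono_comp_eq]
  obtain ⟨⟨k, hk⟩, y⟩ := y
  refine (Finset.card_bij (fun f _ => Finset.univ.image f) ?_ ?_ ?_).symm
  · intro f hf
    simp only [Finset.mem_filter, Finset.mem_univ, true_and] at hf ⊢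
    have hc : (Finset.univ.image f).card = k := by
      rw [Finset.card_image_of_injective _ hf.1.injective, Finset.card_univ, Fintype.card_fin]
    rw [restrictSub_eq x _ hc hk, ← Finset.orderEmbOfFin_unique hc (fun i => by simp) hf.1]
    exact congrArg _ hf.2
  · intro f hf f' hf' h
    simp only [Finset.mem_filter, Finset.mem_univ, true_and] at hf hf'
    have hr : Set.range f = Set.range f' := by
      simpa using congrArg (fun s : Finset (Fin n) => (s : Set (Fin n))) h
    exact (hf.1.range_inj hf'.1).1 hr
  · intro S hS
    simp only [Finset.mem_filter, Finset.mem_univ, true_and] at hS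
    have hc : S.card = k := by
      have := congrArg (fun z : DelOut n => (z.1 : ℕ)) hS
      exact this
    rw [restrictSub_eq x S hc hk] at hS
    have hy : (fun i => x (S.orderEmbOfFin hc i)) = y := by simpa using hS
    refine ⟨S.orderEmbOfFin hc, ?_, ?_⟩
    · simp only [Finset.mem_filter, Finset.mem_univ, true_and]
      exact ⟨(S.orderEmbOfFin hc).strictMono, hy⟩
    · rw [← Finset.coe_inj, Finset.coe_image, Finset.coe_univ, Set.image_univ,
        Finset.range_orderEmbOfFin]

lemma delW_eq_delProb {n : ℕ} {d : ℝ} (hd : d ≠ 0) (x : Fin n → Bool) (y : DelOut n) :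
    delW d x y = delProb d ((1 - d) / d) (List.ofFn x) (List.ofFn y.2) := by
  have hterm : ∀ S : Finset (Fin n),
      (if restrictSub x S = y then (1 - d) ^ S.card * d ^ (n - S.card) else 0)
        = if restrictSub x S = y then d ^ n * ((1 - d) / d) ^ (y.1 : ℕ) else 0 := fun S => by
    split_ifs with h
    · have hc : S.card = y.1 := congrArg (fun z : DelOut n => (z.1 : ℕ)) h
      have hle : (y.1 : ℕ) ≤ n := Nat.lt_succ_iff.1 y.1.2
      rw [hc, div_pow, pow_sub₀ d hd hle]
      ring
    · rfl
  rw [delW, Finset.sum_congr rfl fun S _ => hterm S, ← Finset.sum_filter, Finset.sum_const,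
    card_restrictSub_eq, nsmul_eq_mul, delProb, List.length_ofFn, List.length_ofFn]

lemma exactW_nonneg {n k : ℕ} (x : Fin n → Bool) (y : Fin k → Bool) : 0 ≤ exactW x y := by
  rw [exactW_eq_exactProb]
  exact exactProb_nonneg _ _ _

lemma sum_exactW {n k : ℕ} (hkn : k ≤ n) (x : Fin n → Bool) :
    ∑ y : Fin k → Bool, exactW x y = 1 := by
  rw [← sum_exactProb (k := k) (x := List.ofFn x) (by simpa using hkn), words,
    Finset.sum_image List.ofFn_injective.injOn]
  exact Finset.sum_congr rfl fun y _ => exactW_eq_exactProb x y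

lemma DelOut.ofFn_injective (n : ℕ) :
    Function.Injective fun y : DelOut n => List.ofFn y.2 := by
  rintro ⟨⟨j, hj⟩, v⟩ ⟨⟨j', hj'⟩, v'⟩ h
  have hjj : j = j' := by simpa using congrArg List.length h
  subst hjj
  have := List.ofFn_injective h
  simpa using this

lemma DelOut.image_ofFn (n : ℕ) :
    (Finset.univ.image fun y : DelOut n => List.ofFn y.2) = wordsLT (n + 1) := by
  ext y
  rw [mem_wordsLT, Finset.mem_image]
  constructor
  · rintro ⟨z, -, rfl⟩
    rw [List.length_ofFn]
    exact z.1.2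
  · intro h
    exact ⟨⟨⟨y.length, h⟩, y.get⟩, Finset.mem_univ _, List.ofFn_get y⟩

lemma delW_nonneg {n : ℕ} {d : ℝ} (hd0 : 0 < d) (hd1 : d < 1) (x : Fin n → Bool)
    (y : DelOut n) : 0 ≤ delW d x y := by
  rw [delW_eq_delProb hd0.ne']
  exact delProb_nonneg hd0.le (div_nonneg (by linarith) hd0.le) _ _

lemma sum_delW {n : ℕ} {d : ℝ} (hd : d ≠ 0) (x : Fin n → Bool) :
    ∑ y : DelOut n, delW d x y = 1 := by
  have hdρ : d + d * ((1 - d) / d) = 1 := by field_simp; ring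
  rw [← sum_delProb_wordsLT hdρ (x := List.ofFn x) (M := n + 1) (by simp), ← DelOut.image_ofFn,
    Finset.sum_image (DelOut.ofFn_injective n).injOn]
  exact Finset.sum_congr rfl fun y _ => delW_eq_delProb hd x y

lemma IsDist.sum_support {α : Type*} [Fintype α] {p : α → ℝ} (hp : IsDist p) :
    ∑ x : {x // p x ≠ 0}, p x = 1 := by
  rw [← Finset.sum_subtype (Finset.univ.filter fun x => p x ≠ 0) (by simp) p,
    Finset.sum_filter_ne_zero, hp.2]

lemma mutualInfo_exactW_le {n k : ℕ} (hkn : k ≤ n) {p : (Fin n → Bool) → ℝ} (hp : IsDist p) :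
    mutualInfo p (exactW (n := n) (k := k)) ≤ k := by
  refine mutualInfo_le_of_infoBound hp exactW_nonneg (sum_exactW hkn) ?_
  have h := infoBound_exactProb_uniform (p := fun x : {x // p x ≠ 0} => p x)
    (fun x => hp.1 x) hp.sum_support k fun x => List.ofFn x.1
  rw [words, InfoBound.image_iff List.ofFn_injective] at h
  exact h.congr fun x y _ => exactW_eq_exactProb _ _

/-! ### Capacities -/

/-- The unnormalized capacity of the exact deletion channel. -/
def exactCapacity (n k : ℕ) : ℝ :=
  ⨆ p : {p : (Fin n → Bool) → ℝ // IsDist p}, mutualInfo p.1 (exactW (n := n) (k := k))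

lemma mutualInfo_exactW_le_exactCapacity {n k : ℕ} (hkn : k ≤ n) {p : (Fin n → Bool) → ℝ}
    (hp : IsDist p) : mutualInfo p (exactW (n := n) (k := k)) ≤ exactCapacity n k :=
  le_ciSup (f := fun p : {p : (Fin n → Bool) → ℝ // IsDist p} =>
      mutualInfo p.1 (exactW (n := n) (k := k)))
    ⟨k, by rintro _ ⟨p, rfl⟩; exact mutualInfo_exactW_le hkn p.2⟩ ⟨p, hp⟩

lemma exactCapacity_nonneg {n k : ℕ} (hkn : k ≤ n) : 0 ≤ exactCapacity n k :=
  Real.iSup_nonneg fun p => mutualInfo_nonneg p.2 exactW_nonneg (sum_exactW hkn)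

lemma infoBound_exactProb_exactCapacity {X : Type} [Fintype X] {p : X → ℝ}
    (hp0 : ∀ x, 0 < p x) (hp : ∑ x, p x = 1) {n k : ℕ} (hkn : k ≤ n) (g : X → List Bool)
    (hg : ∀ x, (g x).length = n) :
    InfoBound p (fun x => exactProb k (g x)) (words k) 1 (exactCapacity n k) := by
  have hex : ∀ x, ∃ v : Fin n → Bool, List.ofFn v = g x := fun x => by
    simpa [words] using mem_words.2 (hg x)
  choose h hh using hex
  set P : (Fin n → Bool) → ℝ := fun u => ∑ x, if h x = u then p x else 0 with hP
  have hsum : ∀ F : (Fin n → Bool) → ℝ, ∑ u, P u * F u = ∑ x, p x * F (h x) := fun F => by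
    simp only [hP, Finset.sum_mul, ite_mul, zero_mul]
    rw [Finset.sum_comm]
    simp
  have hdist : IsDist P := by
    refine ⟨fun u => Finset.sum_nonneg fun x _ => ?_, ?_⟩
    · split_ifs
      exacts [(hp0 x).le, le_rfl]
    · have := hsum fun _ => 1
      simpa [hp] using this
  have hle := mutualInfo_exactW_le_exactCapacity hkn hdist
  simp only [← hh]
  rw [words, InfoBound.image_iff List.ofFn_injective]
  simp only [← exactW_eq_exactProb]
  refine ⟨fun y => ∑ x, p x * exactW (h x) y,
    fun y _ => Finset.sum_nonneg fun x _ => mul_nonneg (hp0 x).le (exactW_nonneg _ _),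
    fun y _ h0 x => ?_, ?_, le_trans (le_of_eq ?_) hle⟩
  · have := (Finset.sum_eq_zero_iff_of_nonneg
      fun x _ => mul_nonneg (hp0 x).le (exactW_nonneg _ _)).1 h0 x (Finset.mem_univ x)
    exact (mul_eq_zero.1 this).resolve_left (hp0 x).ne'
  · rw [Finset.sum_comm]
    simp only [← Finset.mul_sum, sum_exactW hkn, mul_one, hp, le_refl]
  · simp only [mutualInfo, mul_assoc, ← Finset.mul_sum]
    rw [hsum fun u => ∑ y, exactW u y * Real.logb 2 (exactW u y / ∑ x', P x' * exactW x' y)]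
    refine Finset.sum_congr rfl fun x _ => ?_
    congr 1
    refine Finset.sum_congr rfl fun y _ => ?_
    rw [entropyTerm, hsum fun u => exactW u y]

lemma waiting_mass_le {d ρ : ℝ} (hd : 0 < d) (hρ : 0 < ρ) (hdρ : d + d * ρ = 1) {k : ℕ}
    (hk : 1 ≤ k) (s : ℕ) : d * ρ * binomMass d ρ s k ≤ (d * ρ) ^ 2 * s.choose k := by
  have hδ : 0 < d * ρ := by positivity
  rcases lt_or_ge s k with hsk | hks
  · simp [binomMass, Nat.choose_eq_zero_of_lt hsk]
  have hpow : d ^ s * ρ ^ k ≤ d * ρ := by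
    calc d ^ s * ρ ^ k = d ^ (s - k) * (d * ρ) ^ k := by
          rw [mul_pow, ← mul_assoc, ← pow_add, Nat.sub_add_cancel hks]
      _ ≤ 1 * (d * ρ) ^ k :=
          mul_le_mul_of_nonneg_right (pow_le_one₀ hd.le (by linarith)) (by positivity)
      _ ≤ d * ρ := by
          rw [one_mul]
          exact pow_le_of_le_one hδ.le (by linarith) (by omega)
  rw [binomMass, pow_two, mul_assoc (d * ρ) (d * ρ), mul_comm (d * ρ) (s.choose k : ℝ)]
  gcongr

lemma block_cost_le {d ρ : ℝ} (hd : 0 < d) (hρ : 0 < ρ) (hdρ : d + d * ρ = 1) {k : ℕ}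
    (hk : 1 ≤ k) {G : ℝ} (hG : 0 ≤ G) (n N : ℕ) :
    ∑ s ∈ Finset.range N, d * ρ * binomMass d ρ s k * ((if s < n then (k : ℝ) else G) + 1) ≤
      (d * ρ * ((G + 1) / (k + 1))
          + (d * ρ) ^ 2 * (k * ∑ s ∈ Finset.range n, (s.choose k : ℝ))) *
        (∑ s ∈ Finset.range N, d * ρ * binomMass d ρ s k * (s + 1)
          + N * ∑ j ∈ Finset.range (k + 1), binomMass d ρ N j) := by
  rcases Nat.eq_zero_or_pos N with rfl | hN
  · simp
  have hb := binomMass_nonneg hd.le hρ.le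
  have hπ : ∀ s, 0 ≤ d * ρ * binomMass d ρ s k := fun s => mul_nonneg (by positivity) (hb s k)
  set P := ∑ s ∈ Finset.range N, d * ρ * binomMass d ρ s k with hP
  set Q := ∑ j ∈ Finset.range (k + 1), binomMass d ρ N j with hQ
  set m := ∑ s ∈ Finset.range N, d * ρ * binomMass d ρ s k * (s + 1) + N * Q with hm
  set c : ℝ := k * ∑ s ∈ Finset.range n, (s.choose k : ℝ) with hc
  have hQ0 : 0 ≤ Q := Finset.sum_nonneg fun j _ => hb N j
  have hPQ : P + Q = 1 := sum_waiting_add_sum_binomMass hdρ k N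
  have hwald : (k + 1) * P ≤ d * ρ * m := by
    rw [hm, wald_binomMass hdρ k N]
    exact le_add_of_nonneg_right
      (Finset.sum_nonneg fun j _ => mul_nonneg (Nat.cast_nonneg j) (hb N j))
  have hm1 : 1 ≤ m := by
    rw [← hPQ]
    refine add_le_add (Finset.sum_le_sum fun s _ => ?_) ?_
    · exact le_mul_of_one_le_right (hπ s) (by simp)
    · exact le_mul_of_one_le_left hQ0 (by exact_mod_cast hN)
  have hc0 : 0 ≤ c := by positivity
  have hsmall : ∑ s ∈ Finset.range N,
      d * ρ * binomMass d ρ s k * (if s < n then (k : ℝ) else 0) ≤ (d * ρ) ^ 2 * c := by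
    calc _ = ∑ s ∈ (Finset.range N).filter (· < n), d * ρ * binomMass d ρ s k * k := by
          rw [Finset.sum_filter]
          exact Finset.sum_congr rfl fun s _ => by split_ifs <;> simp
      _ ≤ ∑ s ∈ Finset.range n, d * ρ * binomMass d ρ s k * k :=
          Finset.sum_le_sum_of_subset_of_nonneg (fun s hs => by simp_all)
            fun s _ _ => mul_nonneg (hπ s) (Nat.cast_nonneg k)
      _ ≤ ∑ s ∈ Finset.range n, (d * ρ) ^ 2 * s.choose k * k :=
          Finset.sum_le_sum fun s _ =>
            mul_le_mul_of_nonneg_right (waiting_mass_le hd hρ hdρ hk s) (Nat.cast_nonneg k)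
      _ = (d * ρ) ^ 2 * c := by
          rw [hc, ← Finset.sum_mul, ← Finset.mul_sum]
          ring
  have hsplit : ∑ s ∈ Finset.range N,
      d * ρ * binomMass d ρ s k * ((if s < n then (k : ℝ) else G) + 1) ≤
        (G + 1) * P + (d * ρ) ^ 2 * c := by
    refine le_trans ?_ (add_le_add_right hsmall _)
    rw [hP, Finset.mul_sum, ← Finset.sum_add_distrib]
    refine Finset.sum_le_sum fun s _ => ?_
    rw [mul_comm (G + 1), ← mul_add]
    refine mul_le_mul_of_nonneg_left ?_ (hπ s)
    split_ifs <;> linarith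
  refine hsplit.trans ?_
  rw [add_mul _ _ (m : ℝ)]
  refine add_le_add ?_ (le_mul_of_one_le_right (by positivity) hm1)
  have hk1 : (0 : ℝ) < k + 1 := by positivity
  calc (G + 1) * P = (G + 1) / (k + 1) * ((k + 1) * P) := by field_simp
    _ ≤ (G + 1) / (k + 1) * (d * ρ * m) := mul_le_mul_of_nonneg_left hwald (by positivity)
    _ = _ := by ring

lemma mutualInfo_delW_le_s16 {n k : ℕ} (hk : 1 ≤ k) (hkn : k ≤ n) {d : ℝ} (hd0 : 0 < d) (hd1 : d < 1)
    {N : ℕ} {p : (Fin N → Bool) → ℝ} (hp : IsDist p) :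
    mutualInfo p (delW d) ≤ N * ((1 - d) * ((exactCapacity n k + 1) / (k + 1))
      + (1 - d) ^ 2 * (k * ∑ s ∈ Finset.range n, (s.choose k : ℝ))) + k := by
  refine mutualInfo_le_of_infoBound hp (delW_nonneg hd0 hd1) (sum_delW hd0.ne') ?_
  have hδ : d * ((1 - d) / d) = 1 - d := by field_simp
  have hdρ : d + d * ((1 - d) / d) = 1 := by rw [hδ]; ring
  have hρ : 0 < (1 - d) / d := div_pos (by linarith) hd0
  have hpos : ∀ x : {x // p x ≠ 0}, 0 < p x := fun x => (hp.1 x).lt_of_ne' x.2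
  have ha := block_cost_le hd0 hρ hdρ hk (exactCapacity_nonneg hkn) n
  rw [← hδ]
  have key := infoBound_delProb (p := fun x : {x // p x ≠ 0} => p x) hd0 hρ hdρ
    (fun x => (hpos x).le) hp.sum_support k (fun s g hg => ?_) ha (Nat.lt_succ_self N)
    (fun x => List.ofFn x.1) fun x => List.length_ofFn
  · rw [Nat.succ_eq_add_one, ← DelOut.image_ofFn,
      InfoBound.image_iff (DelOut.ofFn_injective N)] at key
    exact key.congr fun x y _ => delW_eq_delProb hd0.ne' _ _
  · split_ifs with hs
    · exact infoBound_exactProb_uniform (fun x => (hpos x).le) hp.sum_support k g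
    · exact InfoBound.exactProb_of_le (fun x => (hpos x).le) hkn
        (infoBound_exactProb_exactCapacity hpos hp.sum_support hkn) (not_lt.1 hs) g hg

lemma Cn_nonneg (N : ℕ) {d : ℝ} (hd0 : 0 < d) (hd1 : d < 1) : 0 ≤ Cn N d :=
  mul_nonneg (by positivity) (Real.iSup_nonneg fun p =>
    mutualInfo_nonneg p.2 (delW_nonneg hd0 hd1) (sum_delW hd0.ne'))

lemma C_nonneg {d : ℝ} (hd0 : 0 < d) (hd1 : d < 1) : 0 ≤ C d :=
  Real.iInf_nonneg fun N => Cn_nonneg N hd0 hd1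

lemma C_le {n k : ℕ} (hk : 1 ≤ k) (hkn : k ≤ n) {d : ℝ} (hd0 : 0 < d) (hd1 : d < 1) :
    C d ≤ (1 - d) * ((exactCapacity n k + 1) / (k + 1))
      + (1 - d) ^ 2 * (k * ∑ s ∈ Finset.range n, (s.choose k : ℝ)) := by
  set a := (1 - d) * ((exactCapacity n k + 1) / (k + 1))
      + (1 - d) ^ 2 * (k * ∑ s ∈ Finset.range n, (s.choose k : ℝ)) with ha
  have hG := exactCapacity_nonneg hkn
  have hδ : 0 < 1 - d := by linarith
  have ha0 : 0 ≤ a := by positivity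
  have hN : ∀ N : ℕ, C d ≤ a + k / ((N : ℝ) + 1) := fun N => by
    have hle : C d ≤ Cn (N + 1) d :=
      ciInf_le (f := fun m : {m : ℕ // 1 ≤ m} => Cn m d)
        ⟨0, by rintro _ ⟨m, rfl⟩; exact Cn_nonneg m hd0 hd1⟩ ⟨N + 1, by omega⟩
    refine hle.trans ?_
    have hsup : ⨆ p : {p : (Fin (N + 1) → Bool) → ℝ // IsDist p}, mutualInfo p.1 (delW d)
        ≤ ((N + 1 : ℕ) : ℝ) * a + k :=
      Real.iSup_le (fun p => mutualInfo_delW_le_s16 hk hkn hd0 hd1 p.2) (by positivity)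
    calc Cn (N + 1) d ≤ 1 / ((N + 1 : ℕ) : ℝ) * (((N + 1 : ℕ) : ℝ) * a + k) :=
          mul_le_mul_of_nonneg_left hsup (by positivity)
      _ = a + k / ((N : ℝ) + 1) := by
          push_cast
          field_simp
  have hlim : Filter.Tendsto (fun N : ℕ => a + k / ((N : ℝ) + 1)) Filter.atTop (nhds a) := by
    have h := (tendsto_one_div_add_atTop_nhds_zero_nat (𝕜 := ℝ)).const_mul (k : ℝ)
    simpa [div_eq_mul_inv] using h.const_add a
  exact ge_of_tendsto' hlim hN

/-- For all integers `1 ≤ k ≤ n`,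
`limsup_{d→1⁻} C(d)/(1−d) ≤ (n·C_{n,k} + 1)/(k + 1)`, the limsup being taken along
`d` tending to `1` from the left within `(0,1)`. -/
theorem limsup_C_ratio_le (n k : ℕ) (hk : 1 ≤ k) (hkn : k ≤ n) :
    Filter.limsup (fun d : ℝ => C d / (1 - d)) (nhdsWithin 1 (Set.Ioo 0 1)) ≤
      ((n : ℝ) * Cnk n k + 1) / ((k : ℝ) + 1) := by
  have hn : (n : ℝ) ≠ 0 := by
    have : n ≠ 0 := by omega
    exact_mod_cast this
  have hCnk : (n : ℝ) * Cnk n k = exactCapacity n k := by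
    rw [Cnk, exactCapacity, ← mul_assoc, mul_one_div_cancel hn, one_mul]
  rw [hCnk]
  have := right_nhdsWithin_Ioo_neBot (zero_lt_one (α := ℝ))
  set B : ℝ → ℝ := fun d => (exactCapacity n k + 1) / (k + 1)
    + (1 - d) * (k * ∑ s ∈ Finset.range n, (s.choose k : ℝ)) with hB
  have hmem : ∀ᶠ d : ℝ in nhdsWithin 1 (Set.Ioo 0 1), d ∈ Set.Ioo (0 : ℝ) 1 :=
    eventually_mem_nhdsWithin
  have hle : ∀ᶠ d in nhdsWithin 1 (Set.Ioo 0 1), C d / (1 - d) ≤ B d := by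
    filter_upwards [hmem] with d hd
    have hδ : 0 < 1 - d := by linarith [hd.2]
    rw [div_le_iff₀ hδ]
    refine (C_le hk hkn hd.1 hd.2).trans (le_of_eq ?_)
    rw [hB]
    ring
  have hlim : Filter.Tendsto B (nhdsWithin 1 (Set.Ioo 0 1))
      (nhds ((exactCapacity n k + 1) / (k + 1))) := by
    have hcont : Continuous B := by fun_prop
    have h := hcont.tendsto 1
    simp only [hB, sub_self, zero_mul, add_zero] at h
    exact h.mono_left nhdsWithin_le_nhds
  rw [← hlim.limsup_eq]
  refine Filter.limsup_le_limsup hle ?_ hlim.isBoundedUnder_le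
  refine Filter.isCoboundedUnder_le_of_eventually_le _ (x := 0) ?_
  filter_upwards [hmem] with d hd
  exact div_nonneg (C_nonneg hd.1 hd.2) (by linarith [hd.2])
end
end
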